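/- arXiv:1802.00417 — 4 statements merged into one kernel-verified Lean document; each statement's English description precedes it below -/
import Mathlib

section
/- The quotient ring R = 𝕂[T_{ij},S_k]/⟨g_1,…,g_{r−c}⟩ is an integral domain. -/
open MvPolynomial

noncomputable section

/-- Index type for the variables `T i j` (`Sum.inl ⟨i, j⟩`) and `S k` (`Sum.inr k`). -/
abbrev VarIdx (r m : ℕ) (nn : Fin (r + 1) → ℕ) : Type :=
  (Σ i : Fin (r + 1), Fin (nn i)) ⊕ Fin m

variable (𝕂 : Type) [Field 𝕂]

/-- The monomial `T_i^{l_i} = ∏_j T_{ij}^{l_{ij}}`. -/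
def Tmon (r m : ℕ) (nn : Fin (r + 1) → ℕ)
    (l : ∀ i : Fin (r + 1), Fin (nn i) → ℕ) (i : Fin (r + 1)) :
    MvPolynomial (VarIdx r m nn) 𝕂 :=
  ∏ j : Fin (nn i), (X (Sum.inl ⟨i, j⟩) : MvPolynomial (VarIdx r m nn) 𝕂) ^ l i j

/-- The map sending a column index of the `(c+2)×(c+2)` matrix defining `g_t`
to the corresponding column index of `A`, namely `0, …, c, c + (t+1)`. -/
def colOf (r c : ℕ) (hcr : c ≤ r) (t : Fin (r - c)) (p : Fin (c + 2)) : Fin (r + 1) :=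
  if h : (p : ℕ) ≤ c then ⟨p, by omega⟩
  else ⟨c + 1 + t, by have := t.isLt; omega⟩

/-- The polynomial `g_t`: the determinant of the `(c+2)×(c+2)` matrix whose first
`c+1` rows are formed by the columns `a_0, …, a_c, a_{c+t}` of `A` (as constant
polynomials) and whose last row is `(T_0^{l_0}, …, T_c^{l_c}, T_{c+t}^{l_{c+t}})`. -/
def gPoly (r c m : ℕ) (hcr : c ≤ r) (nn : Fin (r + 1) → ℕ)
    (l : ∀ i : Fin (r + 1), Fin (nn i) → ℕ)
    (A : Matrix (Fin (c + 1)) (Fin (r + 1)) 𝕂) (t : Fin (r - c)) :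
    MvPolynomial (VarIdx r m nn) 𝕂 :=
  Matrix.det (Matrix.of fun q p : Fin (c + 2) =>
    if h : (q : ℕ) < c + 1 then C (A ⟨q, h⟩ (colOf r c hcr t p))
    else Tmon 𝕂 r m nn l (colOf r c hcr t p))

/-- The ring `R = 𝕂[T_{ij}, S_k] / ⟨g_1, …, g_{r-c}⟩`. -/
abbrev RingAP (r c m : ℕ) (hcr : c ≤ r) (nn : Fin (r + 1) → ℕ)
    (l : ∀ i : Fin (r + 1), Fin (nn i) → ℕ)
    (A : Matrix (Fin (c + 1)) (Fin (r + 1)) 𝕂) : Type :=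
  MvPolynomial (VarIdx r m nn) 𝕂 ⧸ Ideal.span (Set.range (gPoly 𝕂 r c m hcr nn l A))

end


theorem mem_range_algebraMap_of_pow_eq_one {K E : Type*} [Field K] [IsAlgClosed K] [Field E]
    [Algebra K E] {x : E} {N : ℕ} (hN : 0 < N) (hx : x ^ N = 1) : x ∈ (algebraMap K E).range := by
  have hint : IsIntegral K x := IsIntegral.of_pow hN (by rw [hx]; exact isIntegral_one)
  exact minpoly.mem_range_of_degree_eq_one K x
    (IsAlgClosed.degree_eq_one_of_irreducible K (minpoly.irreducible hint))

/-- Radicals with pairwise irrational quotients are linearly independent. -/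
theorem linearIndepOn_of_pow_mem {K F E ι : Type*} [Field K] [IsAlgClosed K] [Field F] [Field E]
    [Algebra K F] [Algebra F E] [Algebra K E] [IsScalarTower K F E] [IsGalois F E]
    {N : ℕ} (hN : 0 < N) (y : ι → E) (hy0 : ∀ b, y b ≠ 0)
    (hy : ∀ b, y b ^ N ∈ (algebraMap F E).range) (s : Set ι)
    (hs : ∀ b ∈ s, ∀ b' ∈ s, y b / y b' ∈ (algebraMap F E).range → b = b') :
    LinearIndepOn F y s := by
  have hfix (b : ι) (τ σ : E ≃ₐ[F] E) : σ (τ (y b) / y b) = τ (y b) / y b := by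
    have h1 : (τ (y b) / y b) ^ N = 1 := by
      obtain ⟨z, hz⟩ := hy b
      rw [div_pow, ← map_pow, ← hz, AlgEquiv.commutes, div_self]
      rw [hz]; exact pow_ne_zero _ (hy0 b)
    obtain ⟨k, hk⟩ := mem_range_algebraMap_of_pow_eq_one (K := K) hN h1
    rw [← hk, IsScalarTower.algebraMap_apply K F E, AlgEquiv.commutes]
  let χ (b : ι) : (E ≃ₐ[F] E) →* E :=
    { toFun := fun σ => σ (y b) / y b
      map_one' := by simp [hy0 b]
      map_mul' := fun σ τ => by
        have h := hfix b τ σ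
        rw [map_div₀] at h
        have h0 := hy0 b
        have h1 : σ (y b) ≠ 0 := by simpa using h0
        rw [div_eq_div_iff h1 h0] at h
        rw [AlgEquiv.mul_apply]
        field_simp
        linear_combination h }
  have hχ : Set.InjOn χ s := by
    intro b hb b' hb' h
    refine hs b hb b' hb' ?_
    have hmem : y b / y b' ∈ (⊥ : IntermediateField F E) := by
      rw [InfiniteGalois.mem_bot_iff_fixed]
      intro σ
      have h1 : σ (y b) / y b = σ (y b') / y b' := DFunLike.congr_fun h σ
      have h2 : σ (y b') ≠ 0 := by simpa using hy0 b'
      rw [map_div₀, div_eq_div_iff h2 (hy0 b')]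
      rw [div_eq_div_iff (hy0 b) (hy0 b')] at h1
      linear_combination h1
    exact IntermediateField.mem_bot.1 hmem
  rw [linearIndepOn_iff']
  intro t g hts hsum b hb
  have hlin := (linearIndependent_monoidHom (E ≃ₐ[F] E) E).comp (fun b : s => χ b)
    (fun b b' h => Subtype.ext (hχ b.2 b'.2 h))
  have hlin' : LinearIndepOn E (fun b => (χ b : (E ≃ₐ[F] E) → E)) s := hlin
  rw [linearIndepOn_iff'] at hlin'
  have := hlin' t (fun b => algebraMap F E (g b) * y b) hts ?_ b hb
  · simpa [hy0 b] using this
  · ext σ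
    have := congrArg σ hsum
    simp only [map_sum, map_smul, map_zero] at this
    rw [Finset.sum_apply, Pi.zero_apply, ← this]
    refine Finset.sum_congr rfl fun b _ => ?_
    simp only [Pi.smul_apply, smul_eq_mul, Algebra.smul_def, χ]
    have := hy0 b
    change algebraMap F E (g b) * y b * (σ (y b) / y b) = _
    field_simp

theorem modEq_of_radical_monomials {B E ι : Type*} [CommRing B] [IsDomain B] [WfDvdMonoid B]
    [Field E] [Algebra B E] [FaithfulSMul B E] [Fintype ι] [DecidableEq ι]
    {p : ι → B} (hp : ∀ i, Prime (p i)) (hpa : ∀ i j, p i ∣ p j → i = j)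
    {a : ι → ℕ} (ha : ∀ i, 0 < a i) {x : ι → E} (hx : ∀ i, x i ^ a i = algebraMap B E (p i))
    {u v : B} (hu : u ≠ 0) (hv : v ≠ 0) {β γ : ι → ℕ}
    (h : algebraMap B E u * ∏ i, x i ^ β i = algebraMap B E v * ∏ i, x i ^ γ i) (i : ι) :
    β i ≡ γ i [MOD a i] := by
  let M (i : ι) : ℕ := ∏ j ∈ Finset.univ.erase i, a j
  have hM (i : ι) : a i * M i = ∏ j, a j := Finset.mul_prod_erase _ _ (Finset.mem_univ i)
  have hMpos : 0 < M i := Finset.prod_pos fun j _ => ha j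
  have hpow (δ : ι → ℕ) :
      (∏ j, x j ^ δ j) ^ (∏ j, a j) = algebraMap B E (∏ j, p j ^ (δ j * M j)) := by
    rw [← Finset.prod_pow, map_prod]
    refine Finset.prod_congr rfl fun j _ => ?_
    rw [← hM j, map_pow, ← hx j, ← pow_mul, ← pow_mul]
    ring_nf
  have hB : u ^ (∏ j, a j) * ∏ j, p j ^ (β j * M j) = v ^ (∏ j, a j) * ∏ j, p j ^ (γ j * M j) := by
    apply FaithfulSMul.algebraMap_injective B E
    rw [map_mul, map_mul, ← hpow, ← hpow, map_pow, map_pow, ← mul_pow, ← mul_pow, h]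
  have hmul (w : B) (hw : w ≠ 0) (δ : ι → ℕ) :
      emultiplicity (p i) (w ^ (∏ j, a j) * ∏ j, p j ^ (δ j * M j)) =
        ((a i * multiplicity (p i) w + δ i) * M i : ℕ) := by
    rw [emultiplicity_mul (hp i), emultiplicity_pow (hp i), Finset.emultiplicity_prod (hp i),
      Finset.sum_eq_single i, emultiplicity_pow (hp i),
      (FiniteMultiplicity.of_prime_left (hp i) hw).emultiplicity_eq_multiplicity,
      (FiniteMultiplicity.of_prime_left (hp i) (hp i).ne_zero).emultiplicity_self, ← hM i]
    · push_cast; ring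
    · intro j _ hj
      rw [emultiplicity_pow (hp i), emultiplicity_eq_zero.2 fun h => hj (hpa _ _ h).symm, mul_zero]
    · simp
  have h2 := congrArg (emultiplicity (p i)) hB
  rw [hmul u hu, hmul v hv, Nat.cast_inj] at h2
  have h3 := Nat.eq_of_mul_eq_mul_right hMpos h2
  have h4 : a i * multiplicity (p i) u + β i ≡ a i * multiplicity (p i) v + γ i [MOD a i] :=
    h3 ▸ Nat.ModEq.refl _
  simpa [Nat.ModEq] using h4

theorem linearIndependent_addMonoidAlgebra_single {F E G ι : Type*} [Field F] [Field E]
    [Algebra F E] (W : ι → G) (y : ι → E) (h : ∀ w, LinearIndepOn F y {b | W b = w}) :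
    LinearIndependent F fun b => AddMonoidAlgebra.single (W b) (y b) := by
  classical
  rw [linearIndependent_iff']
  intro s g hsum b hb
  refine linearIndepOn_iff'.1 (h (W b)) (s.filter fun b' => W b' = W b) g
    (fun b' hb' => (Finset.mem_filter.1 hb').2) ?_ b (Finset.mem_filter.2 ⟨hb, rfl⟩)
  have h1 := congrArg (fun f => AddMonoidAlgebra.coeff f (W b)) hsum
  simpa [AddMonoidAlgebra.coeff_sum, Finsupp.finsetSum_apply, Finsupp.single_apply,
    Finset.sum_filter] using h1

section Blocks

variable {ι μ : Type*} {κ : ι → Type*} (l : ∀ i, κ i → ℕ)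

/-- The exponents divisible by none of the block monomials `∏ j, X (i, j) ^ l i j`. -/
def IsBlockReduced (ρ : ((Σ i, κ i) ⊕ μ) →₀ ℕ) : Prop :=
  ∀ i, ∃ j, ρ (Sum.inl ⟨i, j⟩) < l i j

/-- A grading by integer vectors in which the block monomials have weight zero. -/
def blockWeight (o : ∀ i, κ i) : (((Σ i, κ i) ⊕ μ) →₀ ℕ) →+ ((Σ i, κ i) ⊕ μ → ℤ) where
  toFun β := Sum.elim
    (fun s => l s.1 (o s.1) * β (Sum.inl s) - l s.1 s.2 * β (Sum.inl ⟨s.1, o s.1⟩))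
    (fun k => β (Sum.inr k))
  map_zero' := by ext (s | k) <;> simp
  map_add' β γ := by
    ext (s | k)
    · simp; ring
    · simp

variable {l} in
theorem IsBlockReduced.eq_of_blockWeight_eq {o : ∀ i, κ i} (hl : ∀ i, 0 < l i (o i))
    {ρ τ : ((Σ i, κ i) ⊕ μ) →₀ ℕ} (hρ : IsBlockReduced l ρ) (hτ : IsBlockReduced l τ)
    (hw : blockWeight l o ρ = blockWeight l o τ)
    (hmod : ∀ i, ρ (Sum.inl ⟨i, o i⟩) ≡ τ (Sum.inl ⟨i, o i⟩) [MOD l i (o i)]) : ρ = τ := by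
  ext (⟨i, j⟩ | k)
  · obtain ⟨k, hk⟩ := (Nat.modEq_iff_dvd.1 (hmod i))
    have key (j : κ i) : (τ (Sum.inl ⟨i, j⟩) : ℤ) - ρ (Sum.inl ⟨i, j⟩) = k * l i j := by
      have h1 := congrFun hw (Sum.inl ⟨i, j⟩)
      simp only [blockWeight, AddMonoidHom.coe_mk, ZeroHom.coe_mk, Sum.elim_inl] at h1
      have h2 : (l i (o i) : ℤ) ≠ 0 := by exact_mod_cast (hl i).ne'
      apply mul_left_cancel₀ h2
      linear_combination (l i j : ℤ) * hk - h1
    have hk0 : k = 0 := by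
      by_contra hne
      rcases lt_or_gt_of_ne hne with h | h
      · obtain ⟨j, hj⟩ := hρ i
        have := key j
        nlinarith
      · obtain ⟨j, hj⟩ := hτ i
        have := key j
        nlinarith
    have := key j
    rw [hk0, zero_mul] at this
    lia
  · have h1 := congrFun hw (Sum.inr k)
    simpa [blockWeight] using h1

variable {K : Type*} [Field K] (o : ∀ i, κ i)

/-- The exponent of the block monomial `∏ j, X (i, j) ^ l i j`. -/
noncomputable def blockExponent (μ : Type*) [∀ i, Fintype (κ i)] (i : ι) :
    ((Σ i, κ i) ⊕ μ) →₀ ℕ :=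
  ∑ j, Finsupp.single (Sum.inl ⟨i, j⟩) (l i j)

theorem blockExponent_inl [∀ i, Fintype (κ i)] [DecidableEq ι] (i i' : ι) (j : κ i') :
    blockExponent l μ i (Sum.inl ⟨i', j⟩) = if i' = i then l i' j else 0 := by
  classical
  rw [blockExponent, Finsupp.finsetSum_apply]
  split_ifs with h
  · subst h
    rw [Finset.sum_eq_single j] <;> simp +contextual
  · refine Finset.sum_eq_zero fun j' _ => ?_
    rw [Finsupp.single_apply, if_neg]
    intro h'
    simp only [Sum.inl.injEq, Sigma.mk.injEq] at h'
    exact h h'.1.symm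

theorem blockExponent_inr [∀ i, Fintype (κ i)] (i : ι) (k : μ) :
    blockExponent l μ i (Sum.inr k) = 0 := by
  simp [blockExponent, Finsupp.finsetSum_apply]

theorem monomial_blockExponent [∀ i, Fintype (κ i)] (i : ι) :
    monomial (blockExponent l μ i) (1 : K) = ∏ j, X (Sum.inl ⟨i, j⟩) ^ l i j := by
  simp_rw [blockExponent, monomial_sum_one, X_pow_eq_monomial]

/-- Modulo the relations equating block monomials with elements of `B`, block-reduced monomials
span over `B`. -/
theorem exists_sub_sum_blockReduced_mem {B : Type*} [CommRing B] [Algebra K B]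
    [∀ i, Fintype (κ i)] (hl : ∀ i, 0 < l i (o i)) (p : ι → B)
    (θ : B →ₐ[K] MvPolynomial ((Σ i, κ i) ⊕ μ) K) (I : Ideal (MvPolynomial ((Σ i, κ i) ⊕ μ) K))
    (hI : ∀ i, ∏ j, X (Sum.inl ⟨i, j⟩) ^ l i j - θ (p i) ∈ I)
    (f : MvPolynomial ((Σ i, κ i) ⊕ μ) K) :
    ∃ v : {ρ : ((Σ i, κ i) ⊕ μ) →₀ ℕ // IsBlockReduced l ρ} →₀ B,
      f - v.sum (fun ρ b => θ b * monomial ρ.1 1) ∈ I := by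
  classical
  have hmon (n : ℕ) : ∀ β : ((Σ i, κ i) ⊕ μ) →₀ ℕ, β.degree = n →
      ∃ (ρ : {ρ : ((Σ i, κ i) ⊕ μ) →₀ ℕ // IsBlockReduced l ρ}) (b : B),
        monomial β 1 - θ b * monomial ρ.1 1 ∈ I := by
    induction n using Nat.strong_induction_on with
    | _ n ih =>
      intro β hβ
      by_cases hred : IsBlockReduced l β
      · exact ⟨⟨β, hred⟩, 1, by simp⟩
      · simp only [IsBlockReduced, not_forall, not_exists, not_lt] at hred
        obtain ⟨i, hi⟩ := hred
        have hle : blockExponent l μ i ≤ β := by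
          rintro (⟨i', j⟩ | k)
          · rw [blockExponent_inl]
            split_ifs with h
            · subst h
              exact hi j
            · exact Nat.zero_le _
          · simp [blockExponent_inr]
        obtain ⟨γ, rfl⟩ := exists_add_of_le hle
        have hpos : 0 < (blockExponent l μ i).degree := by
          rw [Nat.pos_iff_ne_zero, Ne, Finsupp.degree_eq_zero_iff]
          intro h
          have := DFunLike.congr_fun h (Sum.inl ⟨i, o i⟩)
          rw [blockExponent_inl, if_pos rfl] at this
          exact (hl i).ne' this
        obtain ⟨ρ, b, hb⟩ := ih γ.degree (by rw [← hβ, map_add]; lia) γ rfl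
        refine ⟨ρ, p i * b, ?_⟩
        have hmul : monomial (blockExponent l μ i + γ) (1 : K) =
            monomial (blockExponent l μ i) 1 * monomial γ 1 := by simp
        rw [hmul, monomial_blockExponent, map_mul]
        have := I.add_mem (I.mul_mem_right (monomial γ 1) (hI i)) (I.mul_mem_left (θ (p i)) hb)
        convert this using 1
        ring
  induction f using MvPolynomial.induction_on' with
  | monomial β a =>
    obtain ⟨ρ, b, hb⟩ := hmon _ β rfl
    refine ⟨Finsupp.single ρ (algebraMap K B a * b), ?_⟩
    rw [Finsupp.sum_single_index (by simp)]
    convert I.mul_mem_left (C a) hb using 1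
    rw [mul_sub, C_mul_monomial, mul_one, map_mul, AlgHom.commutes, MvPolynomial.algebraMap_eq,
      mul_assoc]
  | add f g hf hg =>
    obtain ⟨v, hv⟩ := hf
    obtain ⟨w, hw⟩ := hg
    refine ⟨v + w, ?_⟩
    rw [Finsupp.sum_add_index' (by simp) (by intros; rw [map_add, add_mul])]
    convert I.add_mem hv hw using 1
    ring

variable [Fintype ι]

/-- The homomorphism sending the variable `(i, o i)` to a homogeneous multiple of `x i` and every
other variable to a unit, homogeneous with respect to `blockWeight`. -/
noncomputable def radicalHom (K : Type*) {E : Type*} [Field K] [Field E] [Algebra K E]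
    (o : ∀ i, κ i) (x : ι → E) :
    MvPolynomial ((Σ i, κ i) ⊕ μ) K →ₐ[K] AddMonoidAlgebra E ((Σ i, κ i) ⊕ μ → ℤ) :=
  AddMonoidAlgebra.lift K _ _
    { toFun := fun β => AddMonoidAlgebra.single (blockWeight l o β.toAdd)
        (∏ i, x i ^ β.toAdd (Sum.inl ⟨i, o i⟩))
      map_one' := by simp [AddMonoidAlgebra.one_def]
      map_mul' := fun β γ => by
        simp [AddMonoidAlgebra.single_mul_single, pow_add, Finset.prod_mul_distrib] }

variable {E : Type*} [Field E] [Algebra K E] (x : ι → E)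

theorem radicalHom_monomial (β : ((Σ i, κ i) ⊕ μ) →₀ ℕ) :
    radicalHom l K o x (monomial β 1) = AddMonoidAlgebra.single (blockWeight l o β)
      (∏ i, x i ^ β (Sum.inl ⟨i, o i⟩)) := by
  change AddMonoidAlgebra.lift K _ _ _ (AddMonoidAlgebra.single β 1) = _
  rw [AddMonoidAlgebra.lift_single, one_smul]
  rfl

theorem radicalHom_blockMonomial [∀ i, Fintype (κ i)] (i : ι) :
    radicalHom (μ := μ) l K o x (∏ j, X (Sum.inl ⟨i, j⟩) ^ l i j) =
      AddMonoidAlgebra.single 0 (x i ^ l i (o i)) := by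
  classical
  rw [← monomial_blockExponent, radicalHom_monomial]
  congr 1
  · ext (⟨i', j⟩ | k)
    · by_cases h : i' = i
      · subst h
        simp [blockWeight, blockExponent_inl, mul_comm]
      · simp [blockWeight, blockExponent_inl, h]
    · simp [blockWeight, blockExponent_inr]
  · simp [blockExponent_inl]

/-- A system of equations setting the block monomials equal to pairwise non-associated primes of
a factorial domain is prime. -/
theorem ker_radicalHom_le {B F : Type*} [CommRing B] [IsDomain B] [WfDvdMonoid B]
    [IsAlgClosed K] [Field F] [Algebra K B] [Algebra B F] [IsFractionRing B F] [Algebra F E]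
    [Algebra B E] [IsScalarTower B F E] [Algebra K F] [IsScalarTower K F E] [IsGalois F E]
    [∀ i, Fintype (κ i)] (hl : ∀ i, 0 < l i (o i))
    {p : ι → B} (hp : ∀ i, Prime (p i)) (hpa : ∀ i j, p i ∣ p j → i = j)
    (hx : ∀ i, x i ^ l i (o i) = algebraMap B E (p i))
    (θ : B →ₐ[K] MvPolynomial ((Σ i, κ i) ⊕ μ) K)
    (hθ : ∀ b, radicalHom l K o x (θ b) = AddMonoidAlgebra.single 0 (algebraMap B E b))
    (I : Ideal (MvPolynomial ((Σ i, κ i) ⊕ μ) K))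
    (hI : ∀ i, ∏ j, X (Sum.inl ⟨i, j⟩) ^ l i j - θ (p i) ∈ I)
    (hIker : I ≤ RingHom.ker (radicalHom (μ := μ) l K o x)) :
    RingHom.ker (radicalHom (μ := μ) l K o x) ≤ I := by
  classical
  have hBE : Function.Injective (algebraMap B E) := by
    rw [IsScalarTower.algebraMap_eq B F E]
    exact (algebraMap F E).injective.comp (IsFractionRing.injective B F)
  have : FaithfulSMul B E := (faithfulSMul_iff_algebraMap_injective B E).2 hBE
  let y (ρ : {ρ : ((Σ i, κ i) ⊕ μ) →₀ ℕ // IsBlockReduced l ρ}) : E :=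
    ∏ i, x i ^ ρ.1 (Sum.inl ⟨i, o i⟩)
  have hx0 (i) : x i ≠ 0 := by
    intro h
    have := hx i
    rw [h, zero_pow (hl i).ne', eq_comm, map_eq_zero_iff _ hBE] at this
    exact (hp i).ne_zero this
  have hy0 (ρ) : y ρ ≠ 0 := Finset.prod_ne_zero_iff.2 fun i _ => pow_ne_zero _ (hx0 i)
  have hypow (ρ) : y ρ ^ (∏ i, l i (o i)) ∈ (algebraMap F E).range := by
    rw [← Finset.prod_pow]
    refine Subring.prod_mem _ fun i _ => ?_
    rw [← pow_mul, mul_comm, pow_mul]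
    refine Subring.pow_mem _ ?_ _
    rw [← Finset.mul_prod_erase _ _ (Finset.mem_univ i), pow_mul, hx,
      IsScalarTower.algebraMap_apply B F E]
    exact Subring.pow_mem _ ((algebraMap F E).mem_range_self _) _
  have hindep : LinearIndependent F
      fun ρ : {ρ : ((Σ i, κ i) ⊕ μ) →₀ ℕ // IsBlockReduced l ρ} =>
        radicalHom l K o x (monomial ρ.1 1) := by
    simp_rw [radicalHom_monomial]
    refine linearIndependent_addMonoidAlgebra_single
      (fun ρ : {ρ : ((Σ i, κ i) ⊕ μ) →₀ ℕ // IsBlockReduced l ρ} => blockWeight l o ρ.1) y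
      fun w => linearIndepOn_of_pow_mem (K := K) (N := ∏ i, l i (o i))
        (Finset.prod_pos fun i _ => hl i) y hy0 hypow _ ?_
    rintro ρ hρ τ hτ ⟨z, hz⟩
    obtain ⟨u, v, hv, rfl⟩ := IsFractionRing.div_surjective (A := B) z
    have hv0 : v ≠ 0 := nonZeroDivisors.ne_zero hv
    have hvE : algebraMap B E v ≠ 0 := by rwa [Ne, map_eq_zero_iff _ hBE]
    rw [map_div₀, ← IsScalarTower.algebraMap_apply, ← IsScalarTower.algebraMap_apply,
      div_eq_div_iff hvE (hy0 τ)] at hz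
    have hu0 : u ≠ 0 := by
      rintro rfl
      rw [map_zero, zero_mul] at hz
      exact mul_ne_zero (hy0 ρ) hvE hz.symm
    refine Subtype.ext (ρ.2.eq_of_blockWeight_eq hl τ.2 (hρ.trans hτ.symm) fun i => ?_)
    exact modEq_of_radical_monomials hp hpa hl hx hv0 hu0
      (β := fun i => ρ.1 (Sum.inl ⟨i, o i⟩)) (γ := fun i => τ.1 (Sum.inl ⟨i, o i⟩))
      (by rw [hz, mul_comm]) i
  intro f hf
  obtain ⟨v, hv⟩ := exists_sub_sum_blockReduced_mem l o hl p θ I hI f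
  have hzero : radicalHom l K o x (v.sum fun ρ b => θ b * monomial ρ.1 1) = 0 := by
    have := hIker hv
    rw [RingHom.mem_ker] at this hf
    rwa [map_sub, hf, zero_sub, neg_eq_zero] at this
  have hv0 : v = 0 := by
    ext ρ
    by_contra hne
    refine hne (IsFractionRing.injective B F ?_)
    rw [Finsupp.zero_apply, map_zero]
    refine linearIndependent_iff'.1 hindep v.support (fun ρ => algebraMap B F (v ρ)) ?_ ρ
      (Finsupp.mem_support_iff.2 hne)
    rw [← hzero, Finsupp.sum, map_sum]
    refine Finset.sum_congr rfl fun ρ _ => ?_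
    rw [map_mul, hθ, radicalHom_monomial, AddMonoidAlgebra.single_mul_single,
      AddMonoidAlgebra.smul_single, zero_add, Algebra.smul_def, ← IsScalarTower.algebraMap_apply]
  rwa [hv0, Finsupp.sum_zero_index, sub_zero] at hv

end Blocks

section LinearForms

variable {K m n : Type*} [Field K] [Fintype m]

/-- The linear form whose coefficients are the `i`-th column of `Q`. -/
noncomputable def columnForm (Q : Matrix m n K) (i : n) : MvPolynomial m K :=
  ∑ p, C (Q p i) * X p

theorem coeff_single_columnForm (Q : Matrix m n K) (i : n) (p : m) :
    (columnForm Q i).coeff (Finsupp.single p 1) = Q p i := by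
  classical
  rw [columnForm, coeff_sum, Finset.sum_eq_single p]
  · simp
  · intro q _ hq
    rw [coeff_C_mul, coeff_X, if_neg, mul_zero]
    rwa [Finsupp.single_left_inj one_ne_zero]
  · simp

theorem totalDegree_columnForm {Q : Matrix m n K} {i : n} (h : Q.transpose i ≠ 0) :
    (columnForm Q i).totalDegree = 1 := by
  refine IsHomogeneous.totalDegree (IsHomogeneous.sum _ _ _ fun p _ => ?_) fun h0 => h ?_
  · simpa using (isHomogeneous_C m (Q p i)).mul (isHomogeneous_X K p)
  · ext p
    rw [Matrix.transpose_apply, ← coeff_single_columnForm Q i p, h0, coeff_zero, Pi.zero_apply]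

theorem prime_columnForm {Q : Matrix m n K} {i : n} (h : Q.transpose i ≠ 0) :
    Prime (columnForm Q i) := by
  refine (irreducible_of_totalDegree_eq_one (totalDegree_columnForm h) fun x hx => ?_).prime
  obtain ⟨p, hp⟩ := Function.ne_iff.1 h
  have := hx (Finsupp.single p 1)
  rw [coeff_single_columnForm] at this
  exact isUnit_of_dvd_unit this (IsUnit.mk0 _ hp)

theorem exists_smul_eq_of_columnForm_dvd {Q : Matrix m n K} {i j : n} (hi : Q.transpose i ≠ 0)
    (hj : Q.transpose j ≠ 0) (h : columnForm Q i ∣ columnForm Q j) :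
    ∃ k : K, Q.transpose j = k • Q.transpose i := by
  obtain ⟨d, hd⟩ := h
  have hd0 : d ≠ 0 := by
    rintro rfl
    exact (prime_columnForm hj).ne_zero (by rw [hd, mul_zero])
  have hdeg := totalDegree_mul_of_isDomain (prime_columnForm hi).ne_zero hd0
  rw [← hd, totalDegree_columnForm hi, totalDegree_columnForm hj] at hdeg
  obtain ⟨k, rfl⟩ : ∃ k, d = C k := ⟨_, totalDegree_eq_zero_iff_eq_C.1 (by lia)⟩
  refine ⟨k, ?_⟩
  ext p
  rw [Matrix.transpose_apply, ← coeff_single_columnForm Q j p, hd, mul_comm, coeff_C_mul,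
    coeff_single_columnForm]
  rfl

end LinearForms

section Presentation

variable {𝕂 : Type} [Field 𝕂] {r c : ℕ}

/-- The square matrix formed by the first `c + 1` columns of `A`. -/
def leadingBlock (hcr : c ≤ r) (A : Matrix (Fin (c + 1)) (Fin (r + 1)) 𝕂) :
    Matrix (Fin (c + 1)) (Fin (c + 1)) 𝕂 :=
  A.submatrix id (Fin.castLE (by lia))

theorem gPoly_eq_det_fromBlocks (m : ℕ) (hcr : c ≤ r) (nn : Fin (r + 1) → ℕ)
    (l : ∀ i : Fin (r + 1), Fin (nn i) → ℕ) (A : Matrix (Fin (c + 1)) (Fin (r + 1)) 𝕂)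
    (t : Fin (r - c)) :
    gPoly 𝕂 r c m hcr nn l A t = (Matrix.fromBlocks ((leadingBlock hcr A).map C)
      (Matrix.of fun q (_ : Fin 1) => C (A q ⟨c + 1 + t, by lia⟩))
      (Matrix.of fun (_ : Fin 1) (p : Fin (c + 1)) =>
        Tmon 𝕂 r m nn l (Fin.castLE (by lia) p))
      (Matrix.of fun (_ _ : Fin 1) => Tmon 𝕂 r m nn l ⟨c + 1 + t, by lia⟩)).det := by
  have hcol (p : Fin (c + 1)) :
      colOf r c hcr t (Fin.castAdd 1 p) = Fin.castLE (by lia) p := by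
    have : (p : ℕ) ≤ c := by lia
    simp [colOf, this, Fin.ext_iff]
  have hlast (p : Fin 1) : colOf r c hcr t (Fin.natAdd (c + 1) p) = ⟨c + 1 + t, by lia⟩ := by
    have : ¬ (c + 1 + p : ℕ) ≤ c := by lia
    simp [colOf]
  rw [gPoly, ← Matrix.det_submatrix_equiv_self (finSumFinEquiv (m := c + 1) (n := 1))]
  congr 1
  refine Matrix.ext ?_
  rintro (q | q) (p | p)
  · simp [hcol, leadingBlock, Nat.lt_succ_iff.1 q.isLt]
  · simp [hlast, Nat.lt_succ_iff.1 q.isLt]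
  · simp [hcol]
  · simp [hlast]

theorem det_fromBlocks_map_eq {S : Type*} [CommRing S] [Algebra 𝕂 S] {n : Type*} [Fintype n]
    [DecidableEq n] {A : Matrix n n 𝕂} (hA : IsUnit A.det) (a : n → 𝕂) (T : n → S) (s : S) :
    (Matrix.fromBlocks (A.map (algebraMap 𝕂 S))
      (Matrix.of fun q (_ : Fin 1) => algebraMap 𝕂 S (a q))
      (Matrix.of fun (_ : Fin 1) p => T p) (Matrix.of fun (_ _ : Fin 1) => s)).det =
      algebraMap 𝕂 S A.det * (s - ∑ p, algebraMap 𝕂 S (A⁻¹.mulVec a p) * T p) := by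
  have hmul : A.map (algebraMap 𝕂 S) * A⁻¹.map (algebraMap 𝕂 S) = 1 := by
    rw [← Matrix.map_mul, Matrix.mul_nonsing_inv _ hA, Matrix.map_one _ (map_zero _) (map_one _)]
  have hinv : Invertible (A.map (algebraMap 𝕂 S)) := ⟨_, mul_eq_one_comm.1 hmul, hmul⟩
  have hinv' : ⅟(A.map (algebraMap 𝕂 S)) = A⁻¹.map (algebraMap 𝕂 S) := invOf_eq_right_inv hmul
  rw [Matrix.det_fromBlocks₁₁, hinv', RingHom.map_det, Matrix.det_fin_one]
  congr 1
  rw [Matrix.sub_apply, Matrix.mul_assoc, Matrix.mul_apply]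
  congr 1
  refine Finset.sum_congr rfl fun p _ => ?_
  simp [Matrix.mul_apply, Matrix.mulVec, dotProduct, mul_comm]

theorem gPoly_eq (m : ℕ) (hcr : c ≤ r) (nn : Fin (r + 1) → ℕ)
    (l : ∀ i : Fin (r + 1), Fin (nn i) → ℕ) (A : Matrix (Fin (c + 1)) (Fin (r + 1)) 𝕂)
    (hdet : IsUnit (leadingBlock hcr A).det) (t : Fin (r - c)) :
    gPoly 𝕂 r c m hcr nn l A t = C (leadingBlock hcr A).det *
      (Tmon 𝕂 r m nn l ⟨c + 1 + t, by lia⟩ -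
        aeval (fun p : Fin (c + 1) => Tmon 𝕂 r m nn l (Fin.castLE (by lia) p))
          (columnForm ((leadingBlock hcr A)⁻¹ * A) ⟨c + 1 + t, by lia⟩)) := by
  rw [gPoly_eq_det_fromBlocks]
  refine (det_fromBlocks_map_eq (S := MvPolynomial (VarIdx r m nn) 𝕂) hdet
    (fun q => A q ⟨c + 1 + t, by lia⟩) _ _).trans ?_
  rw [columnForm, map_sum, MvPolynomial.algebraMap_eq]
  congr 2
  refine Finset.sum_congr rfl fun p _ => ?_
  rw [map_mul, aeval_C, aeval_X]
  rfl

theorem columnForm_leadingBlock_inv_mul (hcr : c ≤ r)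
    (A : Matrix (Fin (c + 1)) (Fin (r + 1)) 𝕂) (hdet : IsUnit (leadingBlock hcr A).det)
    (p : Fin (c + 1)) :
    columnForm ((leadingBlock hcr A)⁻¹ * A) (Fin.castLE (by lia) p) = X p := by
  have h (q : Fin (c + 1)) : ((leadingBlock hcr A)⁻¹ * A) q (Fin.castLE (by lia) p) =
      (1 : Matrix (Fin (c + 1)) (Fin (c + 1)) 𝕂) q p := by
    rw [← Matrix.nonsing_inv_mul _ hdet]
    rfl
  simp [columnForm, h, Matrix.one_apply, apply_ite C]

theorem isUnit_det_leadingBlock (hcr : c ≤ r) (A : Matrix (Fin (c + 1)) (Fin (r + 1)) 𝕂)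
    (hA : ∀ s : Finset (Fin (r + 1)), s.card = c + 1 →
      LinearIndependent 𝕂 fun j : s => A.transpose (j : Fin (r + 1))) :
    IsUnit (leadingBlock hcr A).det := by
  let e : Fin (c + 1) ↪ Fin (r + 1) := Fin.castLEEmb (by lia)
  have h := hA (Finset.univ.map e) (by simp)
  rw [← Matrix.isUnit_iff_isUnit_det, ← Matrix.linearIndependent_cols_iff_isUnit]
  exact h.comp (fun p => ⟨e p, by simp⟩) fun p q hpq => e.injective (congrArg Subtype.val hpq)

theorem linearIndependent_pair_columns (hc : 0 < c) (hcr : c ≤ r)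
    (A : Matrix (Fin (c + 1)) (Fin (r + 1)) 𝕂)
    (hA : ∀ s : Finset (Fin (r + 1)), s.card = c + 1 →
      LinearIndependent 𝕂 fun j : s => A.transpose (j : Fin (r + 1))) {i j : Fin (r + 1)}
    (hij : i ≠ j) : LinearIndependent 𝕂 ![A.transpose i, A.transpose j] := by
  obtain ⟨s, hs, hcard⟩ := Finset.exists_superset_card_eq (s := {i, j}) (n := c + 1)
    (by rw [Finset.card_pair hij]; lia) (by simp; lia)
  have hi : i ∈ s := hs (by simp)
  have hj : j ∈ s := hs (by simp)
  have := (hA s hcard).comp ![⟨i, hi⟩, ⟨j, hj⟩] (by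
    intro a b hab
    fin_cases a <;> fin_cases b <;> simp_all [eq_comm])
  convert this using 1
  ext a
  fin_cases a <;> rfl

theorem transpose_leadingBlock_inv_mul_ne_smul (hc : 0 < c) (hcr : c ≤ r)
    (A : Matrix (Fin (c + 1)) (Fin (r + 1)) 𝕂)
    (hA : ∀ s : Finset (Fin (r + 1)), s.card = c + 1 →
      LinearIndependent 𝕂 fun j : s => A.transpose (j : Fin (r + 1))) {i j : Fin (r + 1)}
    (hij : i ≠ j) (k : 𝕂) :
    ((leadingBlock hcr A)⁻¹ * A).transpose j ≠ k • ((leadingBlock hcr A)⁻¹ * A).transpose i := by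
  intro h
  have hcol (i : Fin (r + 1)) : (leadingBlock hcr A).mulVec
      (((leadingBlock hcr A)⁻¹ * A).transpose i) = A.transpose i := by
    have : (leadingBlock hcr A * ((leadingBlock hcr A)⁻¹ * A)).transpose i = A.transpose i := by
      rw [← Matrix.mul_assoc, Matrix.mul_nonsing_inv _ (isUnit_det_leadingBlock hcr A hA),
        Matrix.one_mul]
    exact this
  have h1 := congrArg (leadingBlock hcr A).mulVec h
  rw [Matrix.mulVec_smul, hcol, hcol] at h1
  have h2 := LinearIndependent.pair_iff.1 (linearIndependent_pair_columns hc hcr A hA hij) k (-1)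
    (by rw [h1, neg_one_smul, add_neg_cancel])
  simp at h2

end Presentation

/-- The ideal generated by the `gPoly`s is prime, by comparison with the radicals, in an algebraic
closure, of the linear forms they involve. -/
theorem isPrime_span_gPoly {𝕂 : Type} [Field 𝕂] [IsAlgClosed 𝕂]
    {r c : ℕ} (m : ℕ) (hc : 0 < c) (hcr : c ≤ r)
    (nn : Fin (r + 1) → ℕ) (o : ∀ i, Fin (nn i))
    (l : ∀ i : Fin (r + 1), Fin (nn i) → ℕ) (hl : ∀ i, 0 < l i (o i))
    (A : Matrix (Fin (c + 1)) (Fin (r + 1)) 𝕂)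
    (hA : ∀ s : Finset (Fin (r + 1)), s.card = c + 1 →
      LinearIndependent 𝕂 fun j : s => A.transpose (j : Fin (r + 1)))
    (F E : Type*) [Field F] [Field E] [IsAlgClosed E]
    [Algebra 𝕂 F] [Algebra (MvPolynomial (Fin (c + 1)) 𝕂) F]
    [IsScalarTower 𝕂 (MvPolynomial (Fin (c + 1)) 𝕂) F]
    [IsFractionRing (MvPolynomial (Fin (c + 1)) 𝕂) F]
    [Algebra F E] [Algebra 𝕂 E] [Algebra (MvPolynomial (Fin (c + 1)) 𝕂) E]
    [IsScalarTower (MvPolynomial (Fin (c + 1)) 𝕂) F E] [IsScalarTower 𝕂 F E]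
    [IsScalarTower 𝕂 (MvPolynomial (Fin (c + 1)) 𝕂) E] [IsGalois F E] :
    (Ideal.span (Set.range (gPoly 𝕂 r c m hcr nn l A))).IsPrime := by
  have hdet := isUnit_det_leadingBlock hcr A hA
  set Q := (leadingBlock hcr A)⁻¹ * A
  set I := Ideal.span (Set.range (gPoly 𝕂 r c m hcr nn l A))
  have hne := fun {i j} => transpose_leadingBlock_inv_mul_ne_smul (i := i) (j := j) hc hcr A hA
  have hQ (i) : Q.transpose i ≠ 0 := by
    obtain ⟨j, hj⟩ : ∃ j : Fin (r + 1), j ≠ i :=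
      have : Nontrivial (Fin (r + 1)) := Fin.nontrivial_iff_two_le.2 (by lia)
      exists_ne i
    have := hne hj 0
    rwa [zero_smul] at this
  choose x hx using fun i => IsAlgClosed.exists_pow_nat_eq
    (algebraMap (MvPolynomial (Fin (c + 1)) 𝕂) E (columnForm Q i)) (hl i)
  let θ : MvPolynomial (Fin (c + 1)) 𝕂 →ₐ[𝕂] MvPolynomial (VarIdx r m nn) 𝕂 :=
    aeval fun p => Tmon 𝕂 r m nn l (Fin.castLE (by lia) p)
  let φ := radicalHom (μ := Fin m) l 𝕂 o x
  have hT (i) : φ (Tmon 𝕂 r m nn l i) =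
      AddMonoidAlgebra.single 0 (algebraMap _ E (columnForm Q i)) := by
    rw [← hx]
    exact radicalHom_blockMonomial l o x i
  have hθ (b) : φ (θ b) = AddMonoidAlgebra.single 0 (algebraMap _ E b) := by
    induction b using MvPolynomial.induction_on with
    | C a =>
      rw [← MvPolynomial.algebraMap_eq, AlgHom.commutes, AlgHom.commutes,
        ← IsScalarTower.algebraMap_apply]
      rfl
    | add f g hf hg => rw [map_add, map_add, hf, hg, map_add, AddMonoidAlgebra.single_add]
    | mul_X f p hf =>
      have hθX : θ (X p) = Tmon 𝕂 r m nn l (Fin.castLE (by lia) p) := aeval_X _ _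
      rw [map_mul, map_mul, hf, hθX, hT, columnForm_leadingBlock_inv_mul hcr A hdet p,
        AddMonoidAlgebra.single_mul_single, zero_add, map_mul]
  have hI (i) : Tmon 𝕂 r m nn l i - θ (columnForm Q i) ∈ I := by
    by_cases hi : (i : ℕ) < c + 1
    · obtain ⟨p, rfl⟩ : ∃ p : Fin (c + 1), Fin.castLE (by lia) p = i := ⟨⟨i, hi⟩, rfl⟩
      rw [columnForm_leadingBlock_inv_mul hcr A hdet p, aeval_X, sub_self]
      exact I.zero_mem
    · let t : Fin (r - c) := ⟨i - (c + 1), by lia⟩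
      have hi' : i = ⟨c + 1 + t, by lia⟩ := by
        ext
        simp [t]
        lia
      have hg : gPoly 𝕂 r c m hcr nn l A t ∈ I := Ideal.subset_span ⟨t, rfl⟩
      rw [gPoly_eq m hcr nn l A hdet t, ← hi'] at hg
      exact (I.unit_mul_mem_iff_mem (hdet.map C)).1 hg
  have hIker : I ≤ RingHom.ker φ := by
    rw [Ideal.span_le]
    rintro _ ⟨t, rfl⟩
    have h : φ (Tmon 𝕂 r m nn l ⟨c + 1 + t, by lia⟩ -
        θ (columnForm Q ⟨c + 1 + t, by lia⟩)) = 0 := by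
      rw [map_sub, hT, hθ, sub_self]
    rw [SetLike.mem_coe, RingHom.mem_ker, gPoly_eq m hcr nn l A hdet t, map_mul]
    exact mul_eq_zero_of_right _ h
  have hker : RingHom.ker φ ≤ I := by
    refine ker_radicalHom_le (F := F) l o x hl
      (fun i => prime_columnForm (hQ i)) (fun i j hdvd => ?_) hx θ hθ I hI hIker
    by_contra hij
    obtain ⟨k, hk⟩ := exists_smul_eq_of_columnForm_dvd (hQ i) (hQ j) hdvd
    exact hne hij k hk
  exact le_antisymm hker hIker ▸ RingHom.ker_isPrime φ

/-- The quotient ring `R = 𝕂[T_{ij},S_k]/⟨g_1,…,g_{r−c}⟩` is an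
integral domain. -/
theorem statement_0
    (𝕂 : Type) [Field 𝕂] [IsAlgClosed 𝕂] [CharZero 𝕂]
    (r c m : ℕ) (hc : 0 < c) (hcr : c ≤ r)
    (nn : Fin (r + 1) → ℕ) (hnn : ∀ i, 0 < nn i)
    (l : ∀ i : Fin (r + 1), Fin (nn i) → ℕ) (hl : ∀ i j, 0 < l i j)
    (A : Matrix (Fin (c + 1)) (Fin (r + 1)) 𝕂)
    (hA : ∀ s : Finset (Fin (r + 1)), s.card = c + 1 →
      LinearIndependent 𝕂 fun j : s => A.transpose (j : Fin (r + 1)))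
    :
    IsDomain (RingAP 𝕂 r c m hcr nn l A) := by
  have := isPrime_span_gPoly m hc hcr nn (fun i => ⟨0, hnn i⟩) l (fun i => hl i _) A hA
    (FractionRing (MvPolynomial (Fin (c + 1)) 𝕂))
    (AlgebraicClosure (FractionRing (MvPolynomial (Fin (c + 1)) 𝕂)))
  exact Ideal.Quotient.isDomain _
end

section
/- The quotient ring R = 𝕂[T_{ij},S_k]/⟨g_1,…,g_{r−c}⟩ is a normal domain, i.e., R is an integral domain that is integrally closed in its field of fractions. -/
open MvPolynomial

namespace Polynomial

universe u

/-- Over a field containing a square root of `-1`, the polynomial `X ^ n - a` is irreducible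
as soon as `a` is not a `p`-th power for every prime divisor `p` of `n`. -/
theorem irreducible_X_pow_sub_C_of_sq_eq_neg_one {k : Type u} [Field k] (hi : ∃ i : k, i ^ 2 = -1)
    {n : ℕ} (hn : n ≠ 0) {a : k} (ha : ∀ p : ℕ, p.Prime → p ∣ n → ∀ b : k, b ^ p ≠ a) :
    Irreducible (X ^ n - C a : k[X]) := by
  induction n using induction_on_primes generalizing k a with
  | zero => exact absurd rfl hn
  | one => simpa using irreducible_X_sub_C a
  | prime_mul p n hp IH =>
    rw [mul_comm]
    apply X_pow_mul_sub_C_irreducible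
      (X_pow_sub_C_irreducible_of_prime hp (ha p hp (dvd_mul_right _ _)))
    intro E _ _ x hx
    have : IsIntegral k x := not_not.mp fun h ↦ by
      simpa only [degree_zero, degree_X_pow_sub_C hp.pos,
        WithBot.natCast_ne_bot] using congr_arg degree (hx.symm.trans (dif_neg h))
    obtain ⟨i, hi⟩ := hi
    apply IH ⟨algebraMap k _ i, by rw [← map_pow, hi]; simp⟩ (right_ne_zero_of_mul hn)
    intro q hq hqn b hb
    have key : Algebra.norm k b ^ q = (-1) ^ p * -a := by
      rw [← map_pow, hb, ← IntermediateField.adjoin.powerBasis_gen this,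
        Algebra.PowerBasis.norm_gen_eq_coeff_zero_minpoly]
      simp [IntermediateField.minpoly_gen, hx, hp.ne_zero.symm]
    obtain ⟨e, he⟩ : ∃ e : k, e ^ q = -(-1) ^ p := by
      rcases neg_one_pow_eq_or k p with h | h
      · rcases hq.eq_two_or_odd' with rfl | hodd
        · exact ⟨i, by rw [h, hi]⟩
        · exact ⟨-1, by rw [h, hodd.neg_one_pow]⟩
      · exact ⟨1, by rw [h]; simp⟩
    refine ha q hq (dvd_mul_of_dvd_right hqn p) (e * Algebra.norm k b) ?_
    rw [mul_pow, key, he]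
    have : ((-1 : k) ^ p) * (-1) ^ p = 1 := by rw [← mul_pow]; simp
    linear_combination a * this

theorem mem_adjoin_gen_of_minpoly_eq_X_pow_sub_C {R k L : Type*} [CommRing R]
    [IsIntegrallyClosed R] [Field k] [Algebra R k] [IsFractionRing R k] [Field L] [Algebra k L]
    [Algebra R L] [IsScalarTower R k L] [CharZero k]
    (B : PowerBasis k L) {a : ℕ} (ha : IsUnit (a : R)) (ha0 : a ≠ 0) {b : R} (hb : IsUnit b)
    (hmin : minpoly k B.gen = X ^ a - C (algebraMap R k b)) {z : L} (hz : IsIntegral R z) :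
    z ∈ Algebra.adjoin R {B.gen} := by
  have : FiniteDimensional k L := B.finite
  have hgen : B.gen ^ a = algebraMap R L b := by
    have := minpoly.aeval k B.gen
    rw [hmin] at this
    simpa [sub_eq_zero, ← IsScalarTower.algebraMap_apply] using this
  have hint : IsIntegral R B.gen :=
    .of_pow (Nat.pos_of_ne_zero ha0) (hgen ▸ isIntegral_algebraMap)
  have hnorm : Algebra.norm k B.gen = (-1) ^ B.dim * -algebraMap R k b := by
    rw [Algebra.PowerBasis.norm_gen_eq_coeff_zero_minpoly, hmin]
    simp [ha0.symm]
  have hdiscr : ∃ u : R, IsUnit u ∧ algebraMap R k u = Algebra.discr k B.basis := by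
    rw [Algebra.discr_powerBasis_eq_norm, hmin]
    simp only [derivative_sub, derivative_X_pow, derivative_C, sub_zero, map_mul, map_pow,
      map_natCast, aeval_X, hnorm]
    rw [show ((a : L)) = algebraMap k L a by simp, Algebra.norm_algebraMap]
    refine ⟨(-1) ^ (Module.finrank k L * (Module.finrank k L - 1) / 2) *
      (a ^ Module.finrank k L * ((-1) ^ B.dim * -b) ^ (a - 1)), ?_, by simp⟩
    exact (isUnit_one.neg.pow _).mul ((ha.pow _).mul (((isUnit_one.neg.pow _).mul hb.neg).pow _))
  obtain ⟨u, hu, hud⟩ := hdiscr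
  have := Algebra.discr_mul_isIntegral_mem_adjoin (R := R) k hint hz
  rw [← hud] at this
  obtain ⟨u, rfl⟩ := hu
  have h2 := Subalgebra.smul_mem _ this (↑u⁻¹ : R)
  rwa [algebraMap_smul, smul_smul, Units.inv_mul, one_smul] at h2

end Polynomial

/-- If an element `z` of an overring is integral over `E` and `x * z ∈ E` for some radical
element `x` of `E`, then `z ∈ E`. -/
theorem IsIntegral.mem_range_of_mul_mem_range {E L : Type*} [CommRing E] [Field L] [Algebra E L]
    (hinj : Function.Injective (algebraMap E L)) {x : E} (hx0 : x ≠ 0)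
    (hx : IsRadical x) {z : L} (hz : IsIntegral E z)
    (hxz : algebraMap E L x * z ∈ (algebraMap E L).range) : z ∈ (algebraMap E L).range := by
  obtain ⟨y, hy⟩ := hxz
  obtain ⟨p, hp, hpz⟩ := hz
  have hroot : (p.scaleRoots x).eval y = 0 := by
    apply hinj
    have := p.scaleRoots_eval₂_mul (algebraMap E L) (r := z) x
    rw [hpz, mul_zero, ← hy, Polynomial.eval₂_at_apply] at this
    rw [this, map_zero]
  have hdvd : x ∣ y ^ p.natDegree := by
    rw [Polynomial.eval_eq_sum_range, Finset.sum_range_succ] at hroot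
    simp only [Polynomial.natDegree_scaleRoots, Polynomial.coeff_scaleRoots, hp.coeff_natDegree,
      Nat.sub_self, pow_zero, mul_one, one_mul] at hroot
    rw [← dvd_neg, ← eq_neg_of_add_eq_zero_left hroot]
    refine Finset.dvd_sum fun i hi ↦ dvd_mul_of_dvd_left (dvd_mul_of_dvd_right ?_ _) _
    exact dvd_pow_self _ (Nat.sub_ne_zero_of_lt (Finset.mem_range.mp hi))
  obtain ⟨w, rfl⟩ := hx _ _ hdvd
  refine ⟨w, mul_left_cancel₀ (a := algebraMap E L x) ?_ (by rw [← hy, map_mul])⟩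
  exact (map_ne_zero_iff _ hinj).mpr hx0

/-- A ring `E` embedded in a field is a normal domain if every element integral over `E` is
multiplied into `E` by a product of radical elements. -/
theorem isIntegrallyClosed_of_exists_mul_mem {E L : Type*} [CommRing E] [Field L]
    [Algebra E L] (hinj : Function.Injective (algebraMap E L)) {S : Set E}
    (hS : ∀ x ∈ S, x ≠ 0 ∧ IsRadical x)
    (hL : ∀ z : L, IsIntegral E z → ∃ M ∈ Submonoid.closure S,
      algebraMap E L M * z ∈ (algebraMap E L).range) :
    IsDomain E ∧ IsIntegrallyClosed E := by
  have hdom : IsDomain E := hinj.isDomain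
  refine ⟨hdom, ?_⟩
  have := (faithfulSMul_iff_algebraMap_injective E L).mpr hinj
  have : IsIntegrallyClosedIn E L := by
    refine isIntegrallyClosedIn_iff.mpr ⟨hinj, fun {z} hz ↦ ?_⟩
    obtain ⟨M, hM, hMz⟩ := hL z hz
    induction hM using Submonoid.closure_induction generalizing z with
    | mem x hx => exact hz.mem_range_of_mul_mem_range hinj (hS x hx).1 (hS x hx).2 hMz
    | one => simpa using hMz
    | mul x y _ _ hx hy =>
      refine hy hz (hx (isIntegral_algebraMap.mul hz) ?_)
      rwa [map_mul, mul_assoc] at hMz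
  exact .of_isIntegrallyClosed_of_isIntegrallyClosedIn _ L

open scoped Polynomial nonZeroDivisors

section

variable {P : Type*} [CommRing P]

/-- Division with remainder by `m * X ^ a - f`, after clearing denominators. -/
theorem exists_pow_mul_sub_dvd (m f : P) {a : ℕ} (ha : a ≠ 0) (q : P[X]) :
    ∃ (N : ℕ) (r : P[X]), r.degree < a ∧
      Polynomial.C m * Polynomial.X ^ a - Polynomial.C f ∣ Polynomial.C (m ^ N) * q - r := by
  induction q using Polynomial.induction_on' with
  | add p q hp hq =>
    obtain ⟨N, r, hr, hd⟩ := hp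
    obtain ⟨N', r', hr', hd'⟩ := hq
    refine ⟨N + N', Polynomial.C (m ^ N') * r + Polynomial.C (m ^ N) * r', ?_, ?_⟩
    · refine (Polynomial.degree_add_le _ _).trans_lt (max_lt ?_ ?_)
      · rw [Polynomial.C_mul']
        exact (Polynomial.degree_smul_le _ _).trans_lt hr
      · rw [Polynomial.C_mul']
        exact (Polynomial.degree_smul_le _ _).trans_lt hr'
    · convert! (hd.mul_left (Polynomial.C (m ^ N'))).add (hd'.mul_left (Polynomial.C (m ^ N)))
        using 1
      simp only [pow_add, map_mul]
      ring
  | monomial n c =>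
    induction n using Nat.strong_induction_on generalizing c with
    | h n ih =>
    by_cases hn : n < a
    · refine ⟨0, Polynomial.monomial n c, ?_, by simp⟩
      exact (Polynomial.degree_monomial_le _ _).trans_lt (by exact_mod_cast hn)
    · obtain ⟨n, rfl⟩ := Nat.exists_eq_add_of_le (not_lt.mp hn)
      obtain ⟨N, r, hr, hd⟩ := ih n (by omega) (f * c)
      refine ⟨N + 1, r, hr, ?_⟩
      have : Polynomial.C (m ^ (N + 1)) * Polynomial.monomial (a + n) c - r =
          (Polynomial.C m * Polynomial.X ^ a - Polynomial.C f) *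
            (Polynomial.C (m ^ N) * Polynomial.monomial n c) +
          (Polynomial.C (m ^ N) * Polynomial.monomial n (f * c) - r) := by
        simp only [← Polynomial.C_mul_X_pow_eq_monomial, pow_add, map_mul, map_pow]
        ring
      rw [this]
      exact (dvd_mul_right _ _).add hd

/-- If `m` is regular modulo `m * X ^ a - f`, this gives membership in the principal ideal from
a vanishing remainder. -/
theorem dvd_of_dvd_C_pow_mul {m : P} {G q : P[X]} (hm : ∀ q, G ∣ Polynomial.C m * q → G ∣ q)
    {N : ℕ} (h : G ∣ Polynomial.C (m ^ N) * q) : G ∣ q := by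
  induction N with
  | zero => simpa using h
  | succ N ih => exact ih (hm _ (by rwa [pow_succ', map_mul, mul_assoc] at h))

theorem isRadical_C_mul_X_pow_sub_C [IsReduced P] (hu : ∀ n : ℕ, n ≠ 0 → IsUnit (n : P))
    {m f : P} (hm : m ∈ P⁰) (hf : f ∈ P⁰) {a : ℕ} (ha : a ≠ 0)
    (hreg : ∀ q, Polynomial.C m * Polynomial.X ^ a - Polynomial.C f ∣ Polynomial.C m * q →
      Polynomial.C m * Polynomial.X ^ a - Polynomial.C f ∣ q) :
    IsRadical (Polynomial.C m * Polynomial.X ^ a - Polynomial.C f) := by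
  intro n q hn
  obtain ⟨N, r, hr, hd⟩ := exists_pow_mul_sub_dvd m f ha q
  suffices r = 0 by
    rw [this, sub_zero] at hd
    exact dvd_of_dvd_C_pow_mul hreg hd
  have hrn : Polynomial.C m * Polynomial.X ^ a - Polynomial.C f ∣ r ^ n := by
    have h1 := hd.trans (sub_dvd_pow_sub_pow _ _ n)
    rw [mul_pow] at h1
    exact (dvd_sub_right (hn.mul_left _)).mp h1
  ext i
  refine (mul_left_mem_nonZeroDivisors_eq_zero_iff (mul_mem hm hf)).mp
    (IsReduced.eq_zero _ (mem_nilradical.mp ?_))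
  rw [nilradical_eq_sInf, Ideal.mem_sInf]
  intro p hp
  have : p.IsPrime := hp
  by_cases hmp : m ∈ p
  · exact p.mul_mem_right _ (p.mul_mem_right _ hmp)
  by_cases hfp : f ∈ p
  · exact p.mul_mem_right _ (p.mul_mem_left _ hfp)
  refine p.mul_mem_left _ ?_
  let φ : P →+* FractionRing (P ⧸ p) := (algebraMap _ _).comp (Ideal.Quotient.mk p)
  have hφ (x : P) : φ x = 0 ↔ x ∈ p := by
    rw [RingHom.comp_apply, map_eq_zero_iff _ (IsFractionRing.injective _ _),
      Ideal.Quotient.eq_zero_iff_mem]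
  have hsep : (Polynomial.X ^ a - Polynomial.C (φ f / φ m)).Separable := by
    refine Polynomial.separable_X_pow_sub_C _ ?_ (div_ne_zero (mt (hφ f).mp hfp) (mt (hφ m).mp hmp))
    simpa using ((hu a ha).map φ).ne_zero
  have hdvd := Polynomial.map_dvd φ hrn
  have hm0 := mt (hφ m).mp hmp
  have hG : (Polynomial.C m * Polynomial.X ^ a - Polynomial.C f).map φ =
      Polynomial.C (φ m) * (Polynomial.X ^ a - Polynomial.C (φ f / φ m)) := by
    rw [mul_sub, ← Polynomial.C_mul, mul_div_cancel₀ _ hm0]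
    simp
  rw [hG, Polynomial.map_pow] at hdvd
  have h0 : r.map φ = 0 := by
    refine Polynomial.eq_zero_of_dvd_of_degree_lt
      (hsep.squarefree.isRadical n _ ((dvd_mul_left _ _).trans hdvd)) ?_
    rw [Polynomial.degree_X_pow_sub_C (Nat.pos_of_ne_zero ha)]
    exact Polynomial.degree_map_le.trans_lt hr
  rw [← hφ, ← Polynomial.coeff_map, h0, Polynomial.coeff_zero]

end

universe u

open scoped Polynomial nonZeroDivisors

theorem isIntegrallyClosed_quotient_C_mul_X_pow_sub_C {P : Type u} [CommRing P] [IsDomain P]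
    [IsIntegrallyClosed P] (hu : ∀ n : ℕ, n ≠ 0 → IsUnit (n : P)) (hi : ∃ i : P, i ^ 2 = -1)
    {m f : P} (hm : m ≠ 0) (hf : f ≠ 0) {a : ℕ} (ha : a ≠ 0)
    (hpow : ∀ p : ℕ, p.Prime → ∀ g h : P, h ≠ 0 → m * g ^ p ≠ f * h ^ p)
    (hreg : ∀ q, Polynomial.C m * Polynomial.X ^ a - Polynomial.C f ∣ Polynomial.C m * q →
      Polynomial.C m * Polynomial.X ^ a - Polynomial.C f ∣ q)
    {S : Set (P[X] ⧸ Ideal.span {Polynomial.C m * Polynomial.X ^ a - Polynomial.C f})}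
    (hS : ∀ x ∈ S, x ≠ 0 ∧ IsRadical x)
    (hmS : Ideal.Quotient.mk _ (Polynomial.C m) ∈ Submonoid.closure S)
    (hXS : Ideal.Quotient.mk _ Polynomial.X ∈ Submonoid.closure S) :
    IsDomain (P[X] ⧸ Ideal.span {Polynomial.C m * Polynomial.X ^ a - Polynomial.C f}) ∧
      IsIntegrallyClosed
        (P[X] ⧸ Ideal.span {Polynomial.C m * Polynomial.X ^ a - Polynomial.C f}) := by
  let k := FractionRing P
  have hinjk : Function.Injective (algebraMap P k) := IsFractionRing.injective P k
  have hmk : algebraMap P k m ≠ 0 := (map_ne_zero_iff _ hinjk).mpr hm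
  have hfk : algebraMap P k f ≠ 0 := (map_ne_zero_iff _ hinjk).mpr hf
  have : CharZero P := charZero_of_inj_zero fun n hn ↦ by
    by_contra h0
    exact (hu n h0).ne_zero hn
  have : CharZero k := charZero_of_injective_algebraMap hinjk
  let b : k := algebraMap P k f / algebraMap P k m
  have hirr : Irreducible (Polynomial.X ^ a - Polynomial.C b) := by
    refine Polynomial.irreducible_X_pow_sub_C_of_sq_eq_neg_one ?_ ha ?_
    · obtain ⟨i, hi⟩ := hi
      exact ⟨algebraMap P k i, by rw [← map_pow, hi]; simp⟩
    · intro p hp _ c hc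
      obtain ⟨g, h, hh, rfl⟩ := IsFractionRing.div_surjective (A := P) c
      have hhk : algebraMap P k h ≠ 0 := (map_ne_zero_iff _ hinjk).mpr (nonZeroDivisors.ne_zero hh)
      refine hpow p hp g h (nonZeroDivisors.ne_zero hh) (hinjk ?_)
      rw [div_pow, div_eq_div_iff (pow_ne_zero _ hhk) hmk] at hc
      simp only [map_mul, map_pow]
      rw [← hc, mul_comm]
  have := Fact.mk hirr
  let L := AdjoinRoot (Polynomial.X ^ a - Polynomial.C b)
  let s : L := AdjoinRoot.root _
  have hsa : s ^ a = algebraMap k L b := by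
    have := AdjoinRoot.eval₂_root (Polynomial.X ^ a - Polynomial.C b)
    simp only [Polynomial.eval₂_sub, Polynomial.eval₂_X_pow, Polynomial.eval₂_C,
      sub_eq_zero] at this
    exact this
  have hs : algebraMap P L m * s ^ a = algebraMap P L f := by
    rw [hsa, IsScalarTower.algebraMap_apply P k L, IsScalarTower.algebraMap_apply P k L, ← map_mul,
      mul_div_cancel₀ _ hmk]
  let I := Ideal.span {Polynomial.C m * Polynomial.X ^ a - Polynomial.C f}
  let ψ : P[X] ⧸ I →+* L := Ideal.Quotient.lift I (Polynomial.aeval s : P[X] →ₐ[P] L).toRingHom (by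
    intro q hq
    obtain ⟨q, rfl⟩ := Ideal.mem_span_singleton.mp hq
    simp [hs])
  have hψ (q : P[X]) : ψ (Ideal.Quotient.mk I q) = Polynomial.aeval s q := rfl
  have hinj : Function.Injective ψ := by
    rw [injective_iff_map_eq_zero]
    intro x hx
    obtain ⟨q, rfl⟩ := Ideal.Quotient.mk_surjective x
    rw [Ideal.Quotient.eq_zero_iff_mem, Ideal.mem_span_singleton]
    obtain ⟨N, r, hr, hd⟩ := exists_pow_mul_sub_dvd m f ha q
    suffices r = 0 by
      rw [this, sub_zero] at hd
      exact dvd_of_dvd_C_pow_mul hreg hd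
    have h1 : ψ (Ideal.Quotient.mk I r) = 0 := by
      have : Ideal.Quotient.mk I (Polynomial.C (m ^ N) * q) = Ideal.Quotient.mk I r :=
        Ideal.Quotient.eq.mpr (Ideal.mem_span_singleton.mpr hd)
      rw [← this, map_mul, map_mul, hx, mul_zero]
    rw [hψ, ← Polynomial.aeval_map_algebraMap k, AdjoinRoot.aeval_eq, AdjoinRoot.mk_eq_zero] at h1
    refine (Polynomial.map_eq_zero_iff hinjk).mp (Polynomial.eq_zero_of_dvd_of_degree_lt h1 ?_)
    rw [Polynomial.degree_X_pow_sub_C (Nat.pos_of_ne_zero ha)]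
    exact Polynomial.degree_map_le.trans_lt hr
  let : Algebra (P[X] ⧸ I) L := ψ.toAlgebra
  refine isIntegrallyClosed_of_exists_mul_mem (L := L) hinj hS fun z hz ↦ ?_
  let R := Localization.Away (f * m)
  have hle : Submonoid.powers (f * m) ≤ P⁰ := by
    rw [Submonoid.powers_le]
    exact mem_nonZeroDivisors_of_ne_zero (mul_ne_zero hf hm)
  have hunit : IsUnit (algebraMap P k (f * m)) := by
    rw [map_mul]
    exact (mul_ne_zero hfk hmk).isUnit
  let : Algebra R k := (IsLocalization.Away.lift (f * m) hunit).toAlgebra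
  have : IsScalarTower P R k := IsScalarTower.of_algebraMap_eq fun x ↦
    (IsLocalization.Away.lift_eq (f * m) hunit x).symm
  have : IsFractionRing R k :=
    IsFractionRing.isFractionRing_of_isDomain_of_isLocalization (Submonoid.powers (f * m)) R k
  have : IsIntegrallyClosed R := isIntegrallyClosed_of_isLocalization R _ hle
  have : IsScalarTower P R L := IsScalarTower.of_algebraMap_eq fun x ↦ by
    rw [IsScalarTower.algebraMap_apply P k L, IsScalarTower.algebraMap_apply R k L,
      ← IsScalarTower.algebraMap_apply P R k]
  have hfm := IsLocalization.Away.algebraMap_isUnit (S := R) (f * m)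
  rw [map_mul] at hfm
  obtain ⟨⟨uf, huf⟩, ⟨um, hum⟩⟩ := IsUnit.mul_iff.mp hfm
  let b' : R := ↑(uf * um⁻¹)
  have hb' : algebraMap R k b' = b := by
    rw [eq_div_iff hmk, IsScalarTower.algebraMap_apply P R k m, ← hum, ← map_mul]
    simp [b', huf, ← IsScalarTower.algebraMap_apply]
  have hX0 := hirr.ne_zero
  let B := AdjoinRoot.powerBasis hX0
  have hmin : minpoly k B.gen = Polynomial.X ^ a - Polynomial.C (algebraMap R k b') := by
    rw [hb', AdjoinRoot.minpoly_powerBasis_gen_of_monic (Polynomial.monic_X_pow_sub_C b ha)]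
  have hsint : IsIntegral R s := by
    refine .of_pow (Nat.pos_of_ne_zero ha) ?_
    have : s ^ a = algebraMap R L b' := by
      rw [IsScalarTower.algebraMap_apply R k L]
      exact hsa.trans (congrArg (algebraMap k L) hb'.symm)
    rw [this]
    exact isIntegral_algebraMap
  have hz' : IsIntegral R z := by
    have hψint (x : P[X] ⧸ I) : ψ x ∈ (integralClosure R L).toSubring := by
      obtain ⟨q, rfl⟩ := Ideal.Quotient.mk_surjective x
      rw [hψ, Polynomial.aeval_eq_sum_range]
      refine sum_mem fun i _ ↦ ?_
      rw [Algebra.smul_def, IsScalarTower.algebraMap_apply P R L]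
      exact mul_mem isIntegral_algebraMap (pow_mem hsint _)
    let θ : P[X] ⧸ I →+* integralClosure R L := ψ.codRestrict (integralClosure R L).toSubring hψint
    obtain ⟨p, hp, hpz⟩ := hz
    refine isIntegral_trans (A := integralClosure R L) z ⟨p.map θ, hp.map θ, ?_⟩
    rw [Polynomial.eval₂_map]
    exact hpz
  have hzmem : z ∈ Algebra.adjoin R {s} :=
    Polynomial.mem_adjoin_gen_of_minpoly_eq_X_pow_sub_C B
      (by simpa using (hu a ha).map (algebraMap P R)) ha (uf * um⁻¹).isUnit hmin hz'
  rw [Algebra.adjoin_singleton_eq_range_aeval] at hzmem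
  obtain ⟨q, rfl⟩ := hzmem
  obtain ⟨_, ⟨n, rfl⟩, hn⟩ := IsLocalization.integerNormalization_spec (Submonoid.powers (f * m)) q
  refine ⟨Ideal.Quotient.mk I (Polynomial.C m) ^ (2 * n) *
      Ideal.Quotient.mk I Polynomial.X ^ (a * n),
    mul_mem (pow_mem hmS _) (pow_mem hXS _), Ideal.Quotient.mk I
      (IsLocalization.integerNormalization (Submonoid.powers (f * m)) q), ?_⟩
  change ψ _ = ψ _ * _
  rw [hψ, ← Polynomial.aeval_map_algebraMap R, hn, AlgHom.map_smul_of_tower, Algebra.smul_def]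
  refine congrArg (· * Polynomial.aeval s q) ?_
  simp only [map_mul, map_pow, hψ, Polynomial.aeval_C, Polynomial.aeval_X]
  rw [mul_comm (algebraMap P L f), ← hs]
  ring

theorem IsRadical.map_ringEquiv {R S : Type*} [CommRing R] [CommRing S] (e : R ≃+* S) {x : R}
    (hx : IsRadical x) : IsRadical (e x) := by
  intro n y h
  obtain ⟨y, rfl⟩ := e.surjective y
  rw [← map_pow, map_dvd_iff] at h
  exact (map_dvd_iff e).mpr (hx n y h)

namespace MvPolynomial

section

variable {σ D : Type*} [CommRing D]

theorem isRegular_C {f : D} (hf : f ∈ D⁰) : IsRegular (C f : MvPolynomial σ D) := by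
  rw [isRegular_iff_mem_nonZeroDivisors, mem_nonZeroDivisors_iff_right]
  intro q hq
  ext i
  have := congrArg (coeff i) hq
  rw [mul_comm, coeff_C_mul] at this
  exact (mul_left_mem_nonZeroDivisors_eq_zero_iff hf).mp this

theorem isRadical_C {f : D} (hf : IsRadical f) : IsRadical (C f : MvPolynomial σ D) := by
  have : IsReduced (D ⧸ Ideal.span {f}) :=
    (Ideal.isRadical_iff_quotient_reduced _).mp (isRadical_iff_span_singleton.mp hf)
  have key (q : MvPolynomial σ D) : C f ∣ q ↔ map (Ideal.Quotient.mk (Ideal.span {f})) q = 0 :=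
    C_dvd_iff_map_hom_eq_zero _ _
      (fun x ↦ by rw [Ideal.Quotient.eq_zero_iff_mem, Ideal.mem_span_singleton]) _
  intro n q h
  rw [key, map_pow] at h
  exact (key q).mpr (IsReduced.eq_zero _ ⟨n, h⟩)

variable [DecidableEq σ]

/-- Substituting `0` for the variable `X j`. -/
noncomputable def killVar (D : Type*) [CommRing D] (j : σ) :
    MvPolynomial σ D →ₐ[D] MvPolynomial σ D :=
  aeval (Function.update X j 0)

@[simp] theorem killVar_X_self (j : σ) : killVar D j (X j) = 0 := by simp [killVar]

theorem X_dvd_sub_killVar (j : σ) (q : MvPolynomial σ D) : X j ∣ q - killVar D j q := by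
  rw [← Ideal.mem_span_singleton, ← Ideal.Quotient.eq]
  refine DFunLike.congr_fun (?_ : Ideal.Quotient.mkₐ D (Ideal.span {X j}) =
    (Ideal.Quotient.mkₐ D (Ideal.span {X j})).comp (killVar D j)) q
  refine algHom_ext fun i ↦ ?_
  by_cases h : i = j
  · subst h
    simp
  · simp [killVar, h]

theorem X_dvd_iff_killVar_eq_zero {j : σ} {q : MvPolynomial σ D} :
    X j ∣ q ↔ killVar D j q = 0 := by
  refine ⟨?_, fun h ↦ by simpa [h] using X_dvd_sub_killVar j q⟩
  rintro ⟨q, rfl⟩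
  simp

end

section

variable {σ : Type*} [Fintype σ] {D : Type*} [CommRing D]

/-- The polynomial `∏ j, X j ^ l j - f`. -/
noncomputable def prodXPowSubC (l : σ → ℕ) (f : D) : MvPolynomial σ D := ∏ j, X j ^ l j - C f

@[simp] theorem map_prodXPowSubC {D' : Type*} [CommRing D'] (φ : D →+* D') (l : σ → ℕ) (f : D) :
    map φ (prodXPowSubC l f) = prodXPowSubC l (φ f) := by
  simp [prodXPowSubC]

variable {l : σ → ℕ} {f : D}

theorem killVar_prodXPowSubC [DecidableEq σ] {j : σ} (hl : l j ≠ 0) :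
    killVar D j (prodXPowSubC l f) = - C f := by
  rw [prodXPowSubC, map_sub, map_prod, Finset.prod_eq_zero (Finset.mem_univ j)]
  · simp [killVar]
  · simp [hl]

theorem prodXPowSubC_dvd_of_dvd_X_mul (hf : f ∈ D⁰) {j : σ} (hl : l j ≠ 0)
    {q : MvPolynomial σ D} (h : prodXPowSubC l f ∣ X j * q) : prodXPowSubC l f ∣ q := by
  classical
  obtain ⟨h, hh⟩ := h
  have h0 := congrArg (killVar D j) hh
  rw [map_mul, map_mul, killVar_prodXPowSubC hl, killVar_X_self, zero_mul, neg_mul, zero_eq_neg,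
    (isRegular_C hf).left.mul_left_eq_zero_iff, ← X_dvd_iff_killVar_eq_zero] at h0
  obtain ⟨w, rfl⟩ := h0
  exact ⟨w, (isRegular_X (n := j)).left (hh.trans (mul_left_comm _ _ _))⟩

theorem prodXPowSubC_dvd_of_dvd_prod_X_mul (hf : f ∈ D⁰) (s : Finset σ) (hl : ∀ j, l j ≠ 0)
    {q : MvPolynomial σ D} (h : prodXPowSubC l f ∣ (∏ j ∈ s, X j ^ l j) * q) :
    prodXPowSubC l f ∣ q := by
  classical
  induction s using Finset.induction_on with
  | empty => simpa using h
  | insert j s hj ih =>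
    rw [Finset.prod_insert hj, mul_assoc] at h
    refine ih ?_
    generalize (∏ j ∈ s, X j ^ l j) * q = q' at h
    generalize l j = n at h
    induction n with
    | zero => simpa using h
    | succ n ihn =>
      refine ihn (prodXPowSubC_dvd_of_dvd_X_mul hf (hl j) ?_)
      rwa [pow_succ', mul_assoc] at h

theorem mk_X_ne_zero (hf : f ∈ D⁰) (hf' : ¬ IsUnit f) {j : σ} (hl : l j ≠ 0) :
    Ideal.Quotient.mk (Ideal.span {prodXPowSubC l f}) (X j) ≠ 0 := by
  classical
  rw [Ne, Ideal.Quotient.eq_zero_iff_mem, Ideal.mem_span_singleton]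
  intro h
  obtain ⟨q, hq⟩ := prodXPowSubC_dvd_of_dvd_X_mul (q := 1) hf hl (by simpa using h)
  have := congrArg (fun q ↦ coeff 0 (killVar D j q)) hq
  simp only [map_mul, killVar_prodXPowSubC hl, map_one] at this
  rw [← map_neg, coeff_C_mul] at this
  exact hf' (isUnit_iff_dvd_one.mpr ⟨- coeff 0 (killVar D j q), by
    simpa using this⟩)

theorem isRadical_mk_X (hf : IsRadical f) {j : σ} (hl : l j ≠ 0) :
    IsRadical (Ideal.Quotient.mk (Ideal.span {prodXPowSubC l f}) (X j)) := by
  classical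
  intro n q h
  obtain ⟨q, rfl⟩ := Ideal.Quotient.mk_surjective q
  obtain ⟨u, hu⟩ := h
  obtain ⟨u, rfl⟩ := Ideal.Quotient.mk_surjective u
  rw [← map_mul, ← map_pow, Ideal.Quotient.eq, Ideal.mem_span_singleton] at hu
  obtain ⟨v, hv⟩ := hu
  have h0 := congrArg (killVar D j) hv
  rw [map_sub, map_mul, map_mul, killVar_prodXPowSubC hl, killVar_X_self, zero_mul, sub_zero,
    map_pow] at h0
  have h1 : C f ∣ killVar D j q ^ n := ⟨- killVar D j v, by rw [h0]; ring⟩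
  obtain ⟨w, hw⟩ := isRadical_C hf n _ h1
  obtain ⟨t, ht⟩ := X_dvd_sub_killVar j q
  obtain ⟨p, hp⟩ : X j ∣ (∏ j, X j ^ l j : MvPolynomial σ D) :=
    (dvd_pow_self _ hl).trans (Finset.dvd_prod_of_mem _ (Finset.mem_univ j))
  refine ⟨Ideal.Quotient.mk _ (t + p * w), ?_⟩
  rw [← map_mul, Ideal.Quotient.eq, Ideal.mem_span_singleton]
  refine ⟨- w, ?_⟩
  rw [prodXPowSubC, hp]
  rw [hw] at ht
  linear_combination ht

end

section

variable {k : ℕ} {D : Type*} [CommRing D] {l : Fin (k + 1) → ℕ} {f : D}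

theorem finSuccEquiv_prodXPowSubC (l : Fin (k + 1) → ℕ) (f : D) :
    finSuccEquiv D k (prodXPowSubC l f) =
      Polynomial.C (∏ j, X j ^ l j.succ) * Polynomial.X ^ l 0 - Polynomial.C (C f) := by
  simp only [prodXPowSubC, map_sub, map_prod, map_pow, Fin.prod_univ_succ, finSuccEquiv_X_zero,
    finSuccEquiv_X_succ, map_mul]
  rw [mul_comm, finSuccEquiv_apply, eval₂Hom_C]
  rfl

theorem isRegular_prod_X_pow {σ : Type*} (s : Finset σ) (l : σ → ℕ) :
    IsRegular (∏ j ∈ s, X j ^ l j : MvPolynomial σ D) :=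
  .prod fun _ _ ↦ isRegular_X_pow _

theorem isRegular_prodXPowSubC (hl : l 0 ≠ 0) : IsRegular (prodXPowSubC l f) := by
  rw [isRegular_iff_mem_nonZeroDivisors, mem_nonZeroDivisors_iff_right]
  intro q hq
  refine (map_eq_zero_iff (finSuccEquiv D k) (finSuccEquiv D k).injective).mp
    ((mem_nonZeroDivisors_iff_right.mp
      (Polynomial.mem_nonZeroDivisors_of_leadingCoeff
        (p := finSuccEquiv D k (prodXPowSubC l f)) ?_))
      _ (by rw [← map_mul, hq, map_zero]))
  nontriviality D
  rw [finSuccEquiv_prodXPowSubC, Polynomial.leadingCoeff_sub_of_degree_lt,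
    Polynomial.leadingCoeff_C_mul_X_pow]
  · exact (isRegular_iff_mem_nonZeroDivisors.mp (isRegular_prod_X_pow _ _))
  · rw [Polynomial.degree_C_mul_X_pow _ (isRegular_prod_X_pow _ _).ne_zero]
    exact Polynomial.degree_C_le.trans_lt (by exact_mod_cast Nat.pos_of_ne_zero hl)

theorem prodXPowSubC_dvd_of_dvd_C_mul {d : D} (hd : d ∈ D⁰) (hl : l 0 ≠ 0)
    {q : MvPolynomial (Fin (k + 1)) D} (h : prodXPowSubC l f ∣ C d * q) : prodXPowSubC l f ∣ q := by
  obtain ⟨h, hh⟩ := h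
  have key (q : MvPolynomial (Fin (k + 1)) D) :
      C d ∣ q ↔ map (Ideal.Quotient.mk (Ideal.span {d})) q = 0 :=
    C_dvd_iff_map_hom_eq_zero _ _
      (fun x ↦ by rw [Ideal.Quotient.eq_zero_iff_mem, Ideal.mem_span_singleton]) _
  have h0 := (key _).mp ⟨q, hh.symm⟩
  rw [map_mul, map_prodXPowSubC, (isRegular_prodXPowSubC hl).left.mul_left_eq_zero_iff, ← key] at h0
  obtain ⟨w, rfl⟩ := h0
  exact ⟨w, (isRegular_C hd).left (hh.trans (mul_left_comm _ _ _))⟩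

theorem finSuccEquiv_prodXPowSubC_dvd_of_dvd (hf : f ∈ D⁰) (hl : ∀ j, l j ≠ 0)
    (q : (MvPolynomial (Fin k) D)[X])
    (h : Polynomial.C (∏ j, X j ^ l j.succ) * Polynomial.X ^ l 0 - Polynomial.C (C f) ∣
      Polynomial.C (∏ j, X j ^ l j.succ) * q) :
    Polynomial.C (∏ j, X j ^ l j.succ) * Polynomial.X ^ l 0 - Polynomial.C (C f) ∣ q := by
  have hC : Polynomial.C (∏ j, X j ^ l j.succ) =
      finSuccEquiv D k (∏ j ∈ Finset.univ.map (Fin.succEmb k), X j ^ l j) := by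
    simp [finSuccEquiv_X_succ]
  obtain ⟨q, rfl⟩ := (finSuccEquiv D k).surjective q
  rw [← finSuccEquiv_prodXPowSubC, hC, ← map_mul, map_dvd_iff] at h
  rw [← finSuccEquiv_prodXPowSubC, map_dvd_iff]
  exact prodXPowSubC_dvd_of_dvd_prod_X_mul hf _ hl h

theorem isRadical_prodXPowSubC [IsReduced D] (hu : ∀ n : ℕ, n ≠ 0 → IsUnit (n : D))
    (hf : f ∈ D⁰) (hl : ∀ j, l j ≠ 0) : IsRadical (prodXPowSubC l f) := by
  have hr := isRadical_C_mul_X_pow_sub_C (P := MvPolynomial (Fin k) D)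
    (m := ∏ j, X j ^ l j.succ) (f := C f)
    (fun n hn ↦ by simpa using (hu n hn).map (C : D →+* MvPolynomial (Fin k) D))
    (isRegular_iff_mem_nonZeroDivisors.mp (isRegular_prod_X_pow _ _))
    (isRegular_iff_mem_nonZeroDivisors.mp (isRegular_C hf)) (hl 0)
    (finSuccEquiv_prodXPowSubC_dvd_of_dvd hf hl)
  rw [← finSuccEquiv_prodXPowSubC] at hr
  intro n q h
  rw [← map_dvd_iff (finSuccEquiv D k)] at h ⊢
  exact hr n _ (by rwa [map_pow] at h)

instance isIntegrallyClosed_fin [IsDomain D] [IsIntegrallyClosed D] (k : ℕ) :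
    IsIntegrallyClosed (MvPolynomial (Fin k) D) := by
  induction k with
  | zero => exact .of_equiv (isEmptyAlgEquiv D (Fin 0)).symm.toRingEquiv
  | succ k ih => exact .of_equiv (finSuccEquiv D k).symm.toRingEquiv

theorem prod_X_pow_mul_pow_ne [IsDomain D] [IsIntegrallyClosed D] (hf : f ≠ 0) (hf' : ¬ IsUnit f)
    (hfr : IsRadical f) (e : Fin k → ℕ) {p : ℕ} (hp : p.Prime) {g h : MvPolynomial (Fin k) D}
    (hh : h ≠ 0) : (∏ j, X j ^ e j) * g ^ p ≠ C f * h ^ p := by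
  intro heq
  have hCf : (C f : MvPolynomial (Fin k) D) ≠ 0 := (isRegular_C (by simpa using hf)).ne_zero
  have hg : g ≠ 0 := by
    rintro rfl
    rw [zero_pow hp.ne_zero, mul_zero, eq_comm] at heq
    exact mul_ne_zero hCf (pow_ne_zero _ hh) heq
  have hpow : (C f * h) ^ p = (C f ^ (p - 1) * ∏ j, X j ^ e j) * g ^ p := by
    rw [mul_assoc, heq, ← mul_assoc, ← pow_succ, Nat.sub_add_cancel hp.one_le, mul_pow]
  obtain ⟨w, hw⟩ := (IsIntegrallyClosed.pow_dvd_pow_iff hp.ne_zero).mp (Dvd.intro_left _ hpow.symm)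
  have hw' : w ^ p = C f ^ (p - 1) * ∏ j, X j ^ e j := by
    rw [hw, mul_pow, mul_comm] at hpow
    exact mul_right_cancel₀ (pow_ne_zero _ hg) hpow
  obtain ⟨v, rfl⟩ := isRadical_C hfr p w
    ⟨C f ^ (p - 2) * ∏ j, X j ^ e j, by
      rw [hw', ← mul_assoc, ← pow_succ']
      congr 2
      have := hp.two_le
      omega⟩
  have h1 : C f * v ^ p = ∏ j, X j ^ e j := by
    refine mul_left_cancel₀ (pow_ne_zero (p - 1) hCf) ?_
    rw [← hw', ← mul_assoc, ← pow_succ, Nat.sub_add_cancel hp.one_le, mul_pow]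
  have h2 := congrArg (eval 1) h1
  simp only [map_mul, eval_C, map_prod, map_pow, eval_X, Pi.one_apply, one_pow,
    Finset.prod_const_one] at h2
  exact hf' (.of_mul_eq_one _ h2)

theorem isIntegrallyClosed_quotient_prodXPowSubC {D : Type u} [CommRing D] {f : D} [IsDomain D]
    [IsIntegrallyClosed D]
    (hu : ∀ n : ℕ, n ≠ 0 → IsUnit (n : D)) (hi : ∃ i : D, i ^ 2 = -1) (hf : f ≠ 0)
    (hf' : ¬ IsUnit f) (hfr : IsRadical f) (hl : ∀ j, l j ≠ 0) :
    IsDomain (MvPolynomial (Fin (k + 1)) D ⧸ Ideal.span {prodXPowSubC l f}) ∧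
      IsIntegrallyClosed (MvPolynomial (Fin (k + 1)) D ⧸ Ideal.span {prodXPowSubC l f}) := by
  have hf0 : f ∈ D⁰ := by simpa using hf
  let G := Polynomial.C (∏ j, X j ^ l j.succ) * Polynomial.X ^ l 0 -
    Polynomial.C (C f : MvPolynomial (Fin k) D)
  let e : (MvPolynomial (Fin (k + 1)) D ⧸ Ideal.span {prodXPowSubC l f}) ≃+*
      ((MvPolynomial (Fin k) D)[X] ⧸ Ideal.span {G}) :=
    Ideal.quotientEquiv _ _ (finSuccEquiv D k).toRingEquiv (by
      rw [Ideal.map_span, Set.image_singleton]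
      exact congrArg (fun q ↦ Ideal.span {q}) (finSuccEquiv_prodXPowSubC l f).symm)
  have he (q) : e (Ideal.Quotient.mk _ q) = Ideal.Quotient.mk _ (finSuccEquiv D k q) := rfl
  let S : Set ((MvPolynomial (Fin k) D)[X] ⧸ Ideal.span {G}) :=
    {x | x ≠ 0 ∧ IsRadical x}
  have hXS (j : Fin (k + 1)) :
      Ideal.Quotient.mk (Ideal.span {G}) (finSuccEquiv D k (X j)) ∈ Submonoid.closure S := by
    refine Submonoid.subset_closure ⟨?_, ?_⟩
    · rw [← he, map_ne_zero_iff e e.injective]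
      exact mk_X_ne_zero hf0 hf' (hl j)
    · rw [← he]
      exact IsRadical.map_ringEquiv (S := (MvPolynomial (Fin k) D)[X] ⧸ Ideal.span {G}) e
        (isRadical_mk_X hfr (hl j))
  obtain ⟨_, _⟩ := isIntegrallyClosed_quotient_C_mul_X_pow_sub_C (P := MvPolynomial (Fin k) D)
    (m := ∏ j, X j ^ l j.succ) (f := C f) (S := S)
    (fun n hn ↦ by simpa using (hu n hn).map (C : D →+* MvPolynomial (Fin k) D))
    (hi.imp' C fun i hi ↦ by rw [← map_pow, hi]; simp)
    (isRegular_prod_X_pow _ _).ne_zero (isRegular_C hf0).ne_zero (hl 0)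
    (fun p hp g h hh ↦ prod_X_pow_mul_pow_ne hf hf' hfr _ hp hh)
    (finSuccEquiv_prodXPowSubC_dvd_of_dvd hf0 hl) (fun x hx ↦ hx)
    (by
      simp only [map_prod, map_pow, ← finSuccEquiv_X_succ]
      exact Submonoid.prod_mem _ fun j _ ↦ pow_mem (hXS _) _)
    (by simpa only [finSuccEquiv_X_zero] using hXS 0)
  exact ⟨e.toMulEquiv.isDomain _,
    .of_equiv (R := (MvPolynomial (Fin k) D)[X] ⧸ Ideal.span {G}) e.symm⟩

end

/-- The polynomials `∏ j, T i j ^ l i j - f i`. -/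
noncomputable def monomialEqPoly {B : Type*} [CommRing B] {s : ℕ} {n : Fin s → ℕ}
    (l : ∀ i, Fin (n i + 1) → ℕ) (f : Fin s → B) (i : Fin s) :
    MvPolynomial (Σ i, Fin (n i + 1)) B :=
  ∏ j, X ⟨i, j⟩ ^ l i j - C (f i)

/-- The `B`-algebra with generators `T i j` and relations `∏ j, T i j ^ l i j = f i`. -/
abbrev MonomialEqRing {B : Type*} [CommRing B] {s : ℕ} {n : Fin s → ℕ}
    (l : ∀ i, Fin (n i + 1) → ℕ) (f : Fin s → B) : Type _ :=
  MvPolynomial (Σ i, Fin (n i + 1)) B ⧸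
    Ideal.span (Set.range (monomialEqPoly l f))

namespace MonomialEqRing

section

variable {B : Type*} [CommRing B]

/-- The generators of `MonomialEqRing`. -/
noncomputable def var {s : ℕ} {n : Fin s → ℕ} (l : ∀ i, Fin (n i + 1) → ℕ) (f : Fin s → B) (i)
    (j : Fin (n i + 1)) : MonomialEqRing l f :=
  Ideal.Quotient.mk _ (X ⟨i, j⟩)

theorem prod_var_pow {s : ℕ} {n : Fin s → ℕ} (l : ∀ i, Fin (n i + 1) → ℕ) (f : Fin s → B) (i) :
    ∏ j, var l f i j ^ l i j = algebraMap B (MonomialEqRing l f) (f i) := by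
  have : Ideal.Quotient.mk (Ideal.span (Set.range (monomialEqPoly l f)))
      (monomialEqPoly l f i) = 0 :=
    Ideal.Quotient.eq_zero_iff_mem.mpr (Ideal.subset_span ⟨i, rfl⟩)
  rw [monomialEqPoly, map_sub, sub_eq_zero, map_prod] at this
  simp only [map_pow] at this
  exact this

/-- The universal property of `MonomialEqRing`. -/
noncomputable def lift {s : ℕ} {n : Fin s → ℕ} {l : ∀ i, Fin (n i + 1) → ℕ} {f : Fin s → B}
    {E : Type*} [CommRing E] (φ : B →+* E) (t : ∀ i, Fin (n i + 1) → E)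
    (h : ∀ i, ∏ j, t i j ^ l i j = φ (f i)) : MonomialEqRing l f →+* E :=
  Ideal.Quotient.lift _ (eval₂Hom φ fun x ↦ t x.1 x.2) (fun a ha ↦ by
    rw [← RingHom.mem_ker]
    refine Ideal.span_le.mpr ?_ ha
    rintro _ ⟨i, rfl⟩
    simp [h, monomialEqPoly])

section

variable {s : ℕ} {n : Fin s → ℕ} {l : ∀ i, Fin (n i + 1) → ℕ} {f : Fin s → B}
  {E : Type*} [CommRing E]

@[simp] theorem lift_var (φ : B →+* E) (t : ∀ i, Fin (n i + 1) → E)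
    (h : ∀ i, ∏ j, t i j ^ l i j = φ (f i)) (i) (j) : lift φ t h (var l f i j) = t i j := by
  simp [lift, var]

@[simp] theorem lift_algebraMap (φ : B →+* E) (t : ∀ i, Fin (n i + 1) → E)
    (h : ∀ i, ∏ j, t i j ^ l i j = φ (f i)) (b : B) :
    lift φ t h (algebraMap B (MonomialEqRing l f) b) = φ b :=
  (Ideal.Quotient.lift_mk _ _ _).trans (eval₂Hom_C _ _ _)

theorem ringHom_ext {φ ψ : MonomialEqRing l f →+* E}
    (h : ∀ b, φ (algebraMap B _ b) = ψ (algebraMap B _ b))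
    (h' : ∀ i j, φ (var l f i j) = ψ (var l f i j)) : φ = ψ :=
  Ideal.Quotient.ringHom_ext (MvPolynomial.ringHom_ext h fun x ↦ h' x.1 x.2)

end

/-- Without relations, `MonomialEqRing` is the base ring. -/
noncomputable def equivZero {n : Fin 0 → ℕ} (l : ∀ i, Fin (n i + 1) → ℕ) (f : Fin 0 → B) :
    MonomialEqRing l f ≃+* B :=
  RingEquiv.ofRingHom (lift (.id B) (fun i ↦ i.elim0) fun i ↦ i.elim0) (algebraMap B _)
    (by ext; simp) (ringHom_ext (by simp) fun i ↦ i.elim0)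

section

variable {s : ℕ} {n : Fin (s + 1) → ℕ} (l : ∀ i, Fin (n i + 1) → ℕ) (f : Fin (s + 1) → B)

/-- `MonomialEqRing` with the first relation left out. -/
abbrev Tail : Type _ := MonomialEqRing (fun i : Fin s ↦ l i.succ) fun i ↦ f i.succ

/-- `MonomialEqRing` as an extension of the ring with the first relation left out. -/
abbrev Step : Type _ :=
  MvPolynomial (Fin (n 0 + 1)) (Tail l f) ⧸
    Ideal.span {prodXPowSubC (l 0) (algebraMap B (Tail l f) (f 0))}

/-- The map adjoining the first relation. -/
noncomputable def tailHom : Tail l f →+* MonomialEqRing l f :=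
  lift (algebraMap B _) (fun i j ↦ var l f i.succ j) fun i ↦ prod_var_pow l f i.succ

/-- The map from `MonomialEqRing` to `Step` exhibiting the iterated quotient. -/
noncomputable def toStep : MonomialEqRing l f →+* Step l f :=
  lift (algebraMap B _)
    (Fin.cases (motive := fun i ↦ Fin (n i + 1) → Step l f)
      (fun j ↦ Ideal.Quotient.mk _ (X j))
      fun i j ↦ algebraMap (Tail l f) _ (var _ _ i j))
    (fun i ↦ by
      cases i using Fin.cases with
      | zero =>
        have : Ideal.Quotient.mk (Ideal.span {prodXPowSubC (l 0) (algebraMap B (Tail l f) (f 0))})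
            (prodXPowSubC (l 0) (algebraMap B (Tail l f) (f 0))) = 0 :=
          Ideal.Quotient.eq_zero_iff_mem.mpr (Ideal.mem_span_singleton_self _)
        rw [prodXPowSubC, map_sub, sub_eq_zero, map_prod] at this
        simp only [map_pow] at this
        exact this
      | succ i =>
        simp only [Fin.cases_succ, ← map_pow, ← map_prod]
        rw [IsScalarTower.algebraMap_apply B (Tail l f) (Step l f)]
        exact congrArg _ (prod_var_pow (fun i ↦ l i.succ) (fun i ↦ f i.succ) i))

/-- The inverse of `toStep`. -/
noncomputable def ofStep : Step l f →+* MonomialEqRing l f :=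
  Ideal.Quotient.lift _ (eval₂Hom (tailHom l f) fun j ↦ var l f 0 j) (fun a ha ↦ by
    rw [← RingHom.mem_ker]
    refine Ideal.span_le.mpr ?_ ha
    rintro _ rfl
    simp [prodXPowSubC, tailHom, prod_var_pow])

theorem toStep_comp_tailHom : (toStep l f).comp (tailHom l f) = algebraMap _ _ :=
  ringHom_ext (fun b ↦ by simp [toStep, tailHom, ← IsScalarTower.algebraMap_apply])
    fun i j ↦ by simp [toStep, tailHom]

theorem ofStep_algebraMap (x : Tail l f) : ofStep l f (algebraMap _ _ x) = tailHom l f x :=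
  (Ideal.Quotient.lift_mk _ _ _).trans (eval₂Hom_C _ _ _)

/-- `MonomialEqRing` can be built by adjoining the first relation last. -/
noncomputable def equivStep : MonomialEqRing l f ≃+* Step l f :=
  RingEquiv.ofRingHom (toStep l f) (ofStep l f)
    (by
      refine Ideal.Quotient.ringHom_ext (MvPolynomial.ringHom_ext (fun x ↦ ?_) fun j ↦ ?_)
      · exact (congrArg (toStep l f) (ofStep_algebraMap l f x)).trans
          (DFunLike.congr_fun (toStep_comp_tailHom l f) x)
      · simp [ofStep, toStep])
    (ringHom_ext (fun b ↦ by
        rw [RingHom.comp_apply, toStep, lift_algebraMap,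
          IsScalarTower.algebraMap_apply B (Tail l f) (Step l f), ofStep_algebraMap]
        simp [tailHom]) fun i j ↦ by
      cases i using Fin.cases with
      | zero => simp [ofStep, toStep]
      | succ i =>
        rw [RingHom.comp_apply, toStep, lift_var, Fin.cases_succ, ofStep_algebraMap]
        simp [tailHom])

theorem equivStep_algebraMap (b : B) : equivStep l f (algebraMap B (MonomialEqRing l f) b) =
    algebraMap (Tail l f) (Step l f) (algebraMap B (Tail l f) b) := by
  rw [equivStep, RingEquiv.ofRingHom_apply, toStep, lift_algebraMap,
    IsScalarTower.algebraMap_apply B (Tail l f) (Step l f)]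

end

theorem algebraMap_mem_nonZeroDivisors {s : ℕ} {n : Fin s → ℕ} {l : ∀ i, Fin (n i + 1) → ℕ}
    (hl : ∀ i j, l i j ≠ 0) (f : Fin s → B) {d : B} (hd : d ∈ B⁰) :
    algebraMap B (MonomialEqRing l f) d ∈ (MonomialEqRing l f)⁰ := by
  induction s with
  | zero =>
    rw [mem_nonZeroDivisors_iff_right]
    intro x hx
    have := congrArg (equivZero l f) hx
    rw [map_mul, map_zero, equivZero, RingEquiv.ofRingHom_apply, RingEquiv.ofRingHom_apply,
      lift_algebraMap] at this
    have := mem_nonZeroDivisors_iff_right.mp hd _ this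
    exact (map_eq_zero_iff (equivZero l f) (equivZero l f).injective).mp this
  | succ s ih =>
    rw [mem_nonZeroDivisors_iff_right]
    intro x hx
    have := congrArg (equivStep l f) hx
    rw [map_mul, map_zero, equivStep_algebraMap] at this
    rw [← map_eq_zero_iff (equivStep l f) (equivStep l f).injective]
    obtain ⟨y, hy⟩ := Ideal.Quotient.mk_surjective (equivStep l f x)
    rw [← hy] at this ⊢
    rw [Ideal.Quotient.eq_zero_iff_mem, Ideal.mem_span_singleton]
    refine prodXPowSubC_dvd_of_dvd_C_mul (ih (fun i j ↦ hl i.succ j) fun i ↦ f i.succ) (hl 0 0) ?_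
    rw [← Ideal.mem_span_singleton, ← Ideal.Quotient.eq_zero_iff_mem, mul_comm, map_mul]
    exact this

theorem nontrivial [IsDomain B] {s : ℕ} {n : Fin s → ℕ} {l : ∀ i, Fin (n i + 1) → ℕ}
    (hl : ∀ i j, l i j ≠ 0) (f : Fin s → B) : Nontrivial (MonomialEqRing l f) := by
  let K := AlgebraicClosure (FractionRing B)
  choose z hz using fun i ↦
    IsAlgClosed.exists_pow_nat_eq (algebraMap B K (f i)) (Nat.pos_of_ne_zero (hl i 0))
  refine (lift (algebraMap B K) (fun i ↦ Fin.cons (z i) 1) fun i ↦ ?_).domain_nontrivial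
  simp [Fin.prod_univ_succ, hz]

theorem isReduced [IsDomain B] (hu : ∀ n : ℕ, n ≠ 0 → IsUnit (n : B)) {s : ℕ} {n : Fin s → ℕ}
    {l : ∀ i, Fin (n i + 1) → ℕ} (hl : ∀ i j, l i j ≠ 0) {f : Fin s → B} (hf : ∀ i, f i ≠ 0) :
    IsReduced (MonomialEqRing l f) := by
  induction s with
  | zero => exact isReduced_of_injective (equivZero l f) (equivZero l f).injective
  | succ s ih =>
    have : IsReduced (Tail l f) := ih (fun i j ↦ hl i.succ j) fun i ↦ hf i.succ
    have hr : IsRadical (prodXPowSubC (l 0) (algebraMap B (Tail l f) (f 0))) :=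
      isRadical_prodXPowSubC
        (fun n hn ↦ by simpa using (hu n hn).map (algebraMap B (Tail l f)))
        (algebraMap_mem_nonZeroDivisors (fun i j ↦ hl i.succ j) _ (by simpa using hf 0)) (hl 0)
    have : IsReduced (Step l f) :=
      (Ideal.isRadical_iff_quotient_reduced _).mp (isRadical_iff_span_singleton.mp hr)
    exact isReduced_of_injective (equivStep l f) (equivStep l f).injective

/-- Reduction of the base ring modulo `d`. -/
noncomputable def modHom {s : ℕ} {n : Fin s → ℕ} (l : ∀ i, Fin (n i + 1) → ℕ) (f : Fin s → B)
    (d : B) :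
    MonomialEqRing l f →+* MonomialEqRing l fun i ↦ Ideal.Quotient.mk (Ideal.span {d}) (f i) :=
  lift ((algebraMap (B ⧸ Ideal.span {d}) _).comp (Ideal.Quotient.mk _)) (var _ _)
    fun i ↦ prod_var_pow _ _ i

theorem modHom_algebraMap {s : ℕ} {n : Fin s → ℕ} (l : ∀ i, Fin (n i + 1) → ℕ) (f : Fin s → B)
    (d b : B) : modHom l f d (algebraMap B _ b) =
      algebraMap (B ⧸ Ideal.span {d}) _ (Ideal.Quotient.mk _ b) :=
  lift_algebraMap _ _ _ b

theorem modHom_var {s : ℕ} {n : Fin s → ℕ} (l : ∀ i, Fin (n i + 1) → ℕ) (f : Fin s → B) (d : B)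
    (i) (j) : modHom l f d (var l f i j) = var l _ i j :=
  lift_var _ _ _ i j

theorem modHom_algebraMap_self {s : ℕ} {n : Fin s → ℕ} (l : ∀ i, Fin (n i + 1) → ℕ)
    (f : Fin s → B) (d : B) : modHom l f d (algebraMap B _ d) = 0 := by
  rw [modHom_algebraMap, Ideal.Quotient.eq_zero_iff_mem.mpr (Ideal.mem_span_singleton_self d),
    map_zero]

theorem map_eq_zero_of_modHom_eq_zero {s : ℕ} {n : Fin s → ℕ} {l : ∀ i, Fin (n i + 1) → ℕ}
    {f : Fin s → B} {d : B} {E : Type*} [CommRing E] (g : MonomialEqRing l f →+* E)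
    (hg : g (algebraMap B _ d) = 0) {x : MonomialEqRing l f} (hx : modHom l f d x = 0) :
    g x = 0 := by
  let ψ : B ⧸ Ideal.span {d} →+* E :=
    Ideal.Quotient.lift _ (g.comp (algebraMap B _)) (fun a ha ↦ by
      obtain ⟨b, rfl⟩ := Ideal.mem_span_singleton.mp ha
      rw [RingHom.comp_apply, map_mul, map_mul, hg, zero_mul])
  have hψ (b : B) : ψ (Ideal.Quotient.mk _ b) = g (algebraMap B _ b) := rfl
  let χ : (MonomialEqRing l fun i ↦ Ideal.Quotient.mk (Ideal.span {d}) (f i)) →+* E :=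
    lift ψ (fun i j ↦ g (var l f i j)) fun i ↦ by
      rw [hψ, ← prod_var_pow, map_prod]
      simp only [map_pow]
  have hχ : χ.comp (modHom l f d) = g := by
    refine ringHom_ext (fun b ↦ ?_) fun i j ↦ ?_
    · rw [RingHom.comp_apply, modHom_algebraMap, lift_algebraMap, hψ]
    · rw [RingHom.comp_apply, modHom_var, lift_var]
  rw [← hχ, RingHom.comp_apply, hx, map_zero]

theorem algebraMap_dvd_of_modHom_eq_zero {s : ℕ} {n : Fin s → ℕ} {l : ∀ i, Fin (n i + 1) → ℕ}
    {f : Fin s → B} {d : B} {x : MonomialEqRing l f} (hx : modHom l f d x = 0) :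
    algebraMap B _ d ∣ x := by
  rw [← Ideal.mem_span_singleton, ← Ideal.Quotient.eq_zero_iff_mem]
  refine map_eq_zero_of_modHom_eq_zero
    (E := MonomialEqRing l f ⧸ Ideal.span {algebraMap B (MonomialEqRing l f) d})
    (Ideal.Quotient.mk (Ideal.span {algebraMap B (MonomialEqRing l f) d})) ?_ hx
  rw [Ideal.Quotient.eq_zero_iff_mem]
  exact Ideal.mem_span_singleton_self _

end

theorem isIntegrallyClosed {B : Type u} [CommRing B] [IsDomain B] [IsIntegrallyClosed B]
    (hu : ∀ n : ℕ, n ≠ 0 → IsUnit (n : B)) (hi : ∃ i : B, i ^ 2 = -1) {s : ℕ} {n : Fin s → ℕ}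
    {l : ∀ i, Fin (n i + 1) → ℕ} (hl : ∀ i j, l i j ≠ 0) {f : Fin s → B}
    (hf : ∀ i, Prime (f i)) (hff : Pairwise fun i j ↦ ¬ f i ∣ f j) :
    IsDomain (MonomialEqRing l f) ∧ IsIntegrallyClosed (MonomialEqRing l f) := by
  induction s with
  | zero => exact ⟨(equivZero l f).toMulEquiv.isDomain _, .of_equiv (equivZero l f).symm⟩
  | succ s ih =>
    obtain ⟨_, _⟩ : IsDomain (Tail l f) ∧ IsIntegrallyClosed (Tail l f) :=
      ih (fun i j ↦ hl i.succ j) (fun i ↦ hf i.succ)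
        fun i j h ↦ hff fun h' ↦ h (Fin.succ_injective _ h')
    have : (Ideal.span {f 0}).IsPrime := (Ideal.span_singleton_prime (hf 0).ne_zero).mpr (hf 0)
    let π := modHom (fun i : Fin s ↦ l i.succ) (fun i ↦ f i.succ) (f 0)
    have hred := isReduced (B := B ⧸ Ideal.span {f 0}) (s := s)
      (fun n hn ↦ by simpa using (hu n hn).map (Ideal.Quotient.mk (Ideal.span {f 0})))
      (l := fun i ↦ l i.succ) (fun i j ↦ hl i.succ j)
      (f := fun i ↦ Ideal.Quotient.mk (Ideal.span {f 0}) (f i.succ)) (fun i ↦ by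
        rw [Ne, Ideal.Quotient.eq_zero_iff_mem, Ideal.mem_span_singleton]
        exact hff (Fin.succ_ne_zero i).symm)
    have hnt := nontrivial (B := B ⧸ Ideal.span {f 0}) (s := s)
      (l := fun i ↦ l i.succ) (fun i j ↦ hl i.succ j)
      fun i ↦ Ideal.Quotient.mk (Ideal.span {f 0}) (f i.succ)
    have hπ : π (algebraMap B (Tail l f) (f 0)) = 0 := modHom_algebraMap_self ..
    have hrad : IsRadical (algebraMap B (Tail l f) (f 0)) := by
      rintro m x ⟨y, hy⟩
      refine algebraMap_dvd_of_modHom_eq_zero (IsReduced.eq_zero (π x) ⟨m, ?_⟩)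
      rw [← map_pow, hy, map_mul, hπ, zero_mul]
    have hunit : ¬ IsUnit (algebraMap B (Tail l f) (f 0)) := by
      intro h
      have := h.map π
      rw [hπ] at this
      exact not_isUnit_zero this
    have hne : algebraMap B (Tail l f) (f 0) ≠ 0 := nonZeroDivisors.ne_zero
      (algebraMap_mem_nonZeroDivisors (fun i j ↦ hl i.succ j) _ (by simpa using (hf 0).ne_zero))
    obtain ⟨_, _⟩ := isIntegrallyClosed_quotient_prodXPowSubC (D := Tail l f) (l := l 0)
      (fun n hn ↦ by simpa using (hu n hn).map (algebraMap B (Tail l f)))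
      (hi.imp' (algebraMap B (Tail l f)) fun i hi ↦ by rw [← map_pow, hi]; simp)
      hne hunit hrad (hl 0)
    exact ⟨(equivStep l f).toMulEquiv.isDomain _, .of_equiv (R := Step l f) (equivStep l f).symm⟩

end MonomialEqRing

end MvPolynomial

namespace Matrix

variable {E : Type*} [CommRing E] {c : ℕ}

/-- The matrix `N` with the additional row `y` at the bottom. -/
def appendRow (N : Matrix (Fin (c + 1)) (Fin (c + 2)) E) (y : Fin (c + 2) → E) :
    Matrix (Fin (c + 2)) (Fin (c + 2)) E :=
  of fun q p ↦ if h : (q : ℕ) < c + 1 then N ⟨q, h⟩ p else y p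

theorem vecMul_appendRow (N : Matrix (Fin (c + 1)) (Fin (c + 2)) E) (y : Fin (c + 2) → E)
    (w : Fin (c + 1) → E) (p : Fin (c + 2)) :
    (Fin.snoc w (-1) ᵥ* appendRow N y : Fin (c + 2) → E) p = ∑ q, w q * N q p - y p := by
  simp [vecMul, dotProduct, Fin.sum_univ_castSucc (n := c + 1), appendRow, sub_eq_add_neg,
    Nat.le_of_lt_succ (Fin.is_lt _)]

theorem vecMul_appendRow_adjugate_last (N : Matrix (Fin (c + 1)) (Fin (c + 2)) E)
    (y : Fin (c + 2) → E) (w : Fin (c + 1) → E) :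
    ((Fin.snoc w (-1) ᵥ* appendRow N y : Fin (c + 2) → E) ᵥ* (appendRow N y).adjugate)
      (Fin.last _) = - (appendRow N y).det := by
  rw [vecMul_vecMul, mul_adjugate, vecMul_smul]
  simp

theorem det_appendRow_eq_zero {N : Matrix (Fin (c + 1)) (Fin (c + 2)) E} {y : Fin (c + 2) → E}
    {w : Fin (c + 1) → E} (h : ∀ p, y p = ∑ q, w q * N q p) : (appendRow N y).det = 0 := by
  have h' : (Fin.snoc w (-1) ᵥ* appendRow N y : Fin (c + 2) → E) = 0 := by
    ext p
    rw [vecMul_appendRow, h, sub_self, Pi.zero_apply]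
  have := vecMul_appendRow_adjugate_last N y w
  rwa [h', zero_vecMul, Pi.zero_apply, eq_comm, neg_eq_zero] at this

theorem eq_sum_of_det_appendRow_eq_zero {N : Matrix (Fin (c + 1)) (Fin (c + 2)) E}
    {y : Fin (c + 2) → E} {w : Fin (c + 1) → E} (hdet : (appendRow N y).det = 0)
    (hN : IsUnit (N.submatrix id Fin.castSucc).det)
    (h : ∀ p : Fin (c + 1), y p.castSucc = ∑ q, w q * N q p.castSucc) :
    y (Fin.last _) = ∑ q, w q * N q (Fin.last _) := by
  have := vecMul_appendRow_adjugate_last N y w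
  have hsub : (appendRow N y).submatrix (Fin.last (c + 1)).succAbove (Fin.last (c + 1)).succAbove =
      N.submatrix id Fin.castSucc := by
    ext i j
    simp [appendRow, Nat.not_lt_of_le (Nat.le_of_lt_succ i.is_lt)]
  rw [hdet, neg_zero, vecMul, dotProduct, Fin.sum_univ_castSucc] at this
  simp only [vecMul_appendRow, h, sub_self, zero_mul, Finset.sum_const_zero, zero_add] at this
  rw [adjugate_fin_succ_eq_det_submatrix, hsub, ← mul_assoc, hN.mul_left_eq_zero,
    (isUnit_one.neg.pow _).mul_left_eq_zero, sub_eq_zero] at this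
  exact this.symm

end Matrix

namespace MvPolynomial

variable {K ι : Type*} (κ : Type*) [Field K] [Fintype ι]

/-- The linear form with coefficients `a` in the left variables. -/
noncomputable def linearForm (a : ι → K) : MvPolynomial (ι ⊕ κ) K :=
  ∑ q, C (a q) * X (.inl q)

theorem map_linearForm {E : Type*} [CommRing E] (φ : MvPolynomial (ι ⊕ κ) K →+* E) (a : ι → K) :
    φ (linearForm κ a) = ∑ q, φ (X (.inl q)) * φ (C (a q)) := by
  simp [linearForm, mul_comm]

theorem prime_linearForm {a : ι → K} (ha : a ≠ 0) : Prime (linearForm κ a) := by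
  have h : linearForm κ a =
      sumSMulX ((Finsupp.equivFunOnFinite.symm a).mapDomain (Sum.inl (β := κ))) := by
    rw [sumSMulX, Finsupp.linearCombination_mapDomain, Finsupp.linearCombination_apply,
      Finsupp.sum_fintype _ _ (by simp)]
    simp [linearForm, smul_eq_C_mul]
  obtain ⟨q, hq⟩ := Function.ne_iff.mp ha
  have hq' : (Finsupp.equivFunOnFinite.symm a).mapDomain (Sum.inl (β := κ)) (.inl q) ≠ 0 := by
    rwa [Finsupp.mapDomain_apply Sum.inl_injective]
  rw [h]
  refine Irreducible.prime
    (irreducible_sumSMulX _ ⟨Sum.inl q, Finsupp.mem_support_iff.mpr hq'⟩ fun x hx ↦ ?_)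
  exact isUnit_of_dvd_unit (hx (.inl q)) (IsUnit.mk0 _ hq')

theorem not_linearForm_dvd {a b : ι → K} (h : b ∉ Submodule.span K {a}) :
    ¬ linearForm κ a ∣ linearForm κ b := by
  classical
  obtain ⟨f, hf, hf'⟩ := Submodule.exists_le_ker_of_notMem h
  have key (x : ι → K) :
      eval (Sum.elim (fun q ↦ f (Pi.single q 1)) 0) (linearForm κ x) = f x := by
    rw [LinearMap.pi_apply_eq_sum_univ f x]
    have hs (q : ι) : (Pi.single q 1 : ι → K) = fun j ↦ if q = j then 1 else 0 := by
      ext j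
      rw [Pi.single_apply, ite_cond_congr (propext eq_comm)]
    simp [linearForm, hs]
  intro hdvd
  have := map_dvd (eval (Sum.elim (fun q ↦ f (Pi.single q 1)) 0)) hdvd
  rw [key, key, LinearMap.mem_ker.mp (hf' (Submodule.mem_span_singleton_self a)),
    zero_dvd_iff] at this
  exact hf this

end MvPolynomial

namespace Matrix

variable {K E : Type*} [Field K] [CommRing E] {c r : ℕ} {hcr : c ≤ r}
  {A : Matrix (Fin (c + 1)) (Fin (r + 1)) K}

/-- The square matrix formed by the first columns of `A`. -/
def leftBlock (hcr : c ≤ r) (A : Matrix (Fin (c + 1)) (Fin (r + 1)) K) :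
    Matrix (Fin (c + 1)) (Fin (c + 1)) K :=
  A.submatrix id (Fin.castLE (Nat.succ_le_succ hcr))

theorem isUnit_leftBlock (hA : ∀ s : Finset (Fin (r + 1)), s.card = c + 1 →
    LinearIndependent K fun j : s ↦ A.transpose (j : Fin (r + 1))) :
    IsUnit (leftBlock hcr A) := by
  let e : Fin (c + 1) ↪ Fin (r + 1) := Fin.castLEEmb (Nat.succ_le_succ hcr)
  have := (hA (Finset.univ.map e) (by simp)).comp
    (fun p ↦ ⟨e p, Finset.mem_map_of_mem e (Finset.mem_univ p)⟩)
    fun p q h ↦ e.injective (congrArg Subtype.val h)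
  exact linearIndependent_cols_iff_isUnit.mp this

theorem eq_of_sum_mul_eq (hA : IsUnit (leftBlock hcr A)) (κ : K →+* E) {w u : Fin (c + 1) → E}
    (h : ∀ i, ∑ q, w q * κ (A q i) = ∑ q, u q * κ (A q i)) : w = u :=
  vecMul_injective_of_isUnit (hA.map κ.mapMatrix) (funext fun _ ↦ h _)

theorem exists_eq_sum_of_det_appendRow_eq_zero (hA : IsUnit (leftBlock hcr A)) (κ : K →+* E)
    (y : Fin (r + 1) → E)
    (h : ∀ t, (appendRow (of fun q p ↦ κ (A q (colOf r c hcr t p)))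
      fun p ↦ y (colOf r c hcr t p)).det = 0) :
    ∃ w : Fin (c + 1) → E, ∀ i, y i = ∑ q, w q * κ (A q i) := by
  obtain ⟨w, hw⟩ := vecMul_surjective_iff_isUnit.mpr (hA.map κ.mapMatrix)
    fun p ↦ y (Fin.castLE (Nat.succ_le_succ hcr) p)
  have hw' (p : Fin (c + 1)) (i : Fin (r + 1)) (hi : i = Fin.castLE (Nat.succ_le_succ hcr) p) :
      y i = ∑ q, w q * κ (A q i) := by
    subst hi
    exact (congrFun hw p).symm
  have hcol (t : Fin (r - c)) (p : Fin (c + 1)) :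
      colOf r c hcr t p.castSucc = Fin.castLE (Nat.succ_le_succ hcr) p := by
    have : (p : ℕ) ≤ c := Nat.le_of_lt_succ p.is_lt
    ext
    simp [colOf, this]
  refine ⟨w, fun i ↦ ?_⟩
  by_cases hi : (i : ℕ) < c + 1
  · exact hw' ⟨i, hi⟩ i rfl
  · let t : Fin (r - c) := ⟨i - (c + 1), by omega⟩
    have hit : i = colOf r c hcr t (Fin.last (c + 1)) := by
      ext
      simp [colOf, t]
      omega
    rw [hit]
    refine eq_sum_of_det_appendRow_eq_zero (h t) ?_ fun p ↦ hw' p _ (hcol t p)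
    have := (isUnit_iff_isUnit_det _).mp (hA.map κ.mapMatrix)
    convert this using 2
    ext q p
    simp [hcol, leftBlock]

end Matrix

namespace RingAP

open MvPolynomial.MonomialEqRing

variable {𝕂 : Type} [Field 𝕂] {r c m : ℕ} {hcr : c ≤ r}

section

variable {nn : Fin (r + 1) → ℕ} {l : ∀ i, Fin (nn i) → ℕ}
  {A : Matrix (Fin (c + 1)) (Fin (r + 1)) 𝕂} {E : Type*} [CommRing E]

theorem map_gPoly (φ : MvPolynomial (VarIdx r m nn) 𝕂 →+* E) (t : Fin (r - c)) :
    φ (gPoly 𝕂 r c m hcr nn l A t) =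
      (Matrix.appendRow (.of fun q p ↦ φ (C (A q (colOf r c hcr t p))))
        fun p ↦ φ (Tmon 𝕂 r m nn l (colOf r c hcr t p))).det := by
  rw [gPoly, RingHom.map_det]
  congr 1
  ext q p
  simp only [Matrix.appendRow, RingHom.mapMatrix_apply, Matrix.map_apply, Matrix.of_apply]
  split <;> rfl

theorem exists_mk_Tmon_eq_sum (hA : IsUnit (Matrix.leftBlock hcr A)) :
    ∃ w : Fin (c + 1) → RingAP 𝕂 r c m hcr nn l A, ∀ i,
      Ideal.Quotient.mk _ (Tmon 𝕂 r m nn l i) =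
        ∑ q, w q * Ideal.Quotient.mk _ (C (A q i)) := by
  refine Matrix.exists_eq_sum_of_det_appendRow_eq_zero hA
    ((Ideal.Quotient.mk (Ideal.span (Set.range (gPoly 𝕂 r c m hcr nn l A)))).comp C)
    (fun i ↦ Ideal.Quotient.mk _ (Tmon 𝕂 r m nn l i)) fun t ↦ ?_
  refine (map_gPoly (Ideal.Quotient.mk _) t).symm.trans ?_
  rw [Ideal.Quotient.eq_zero_iff_mem]
  exact Ideal.subset_span ⟨t, rfl⟩

theorem map_gPoly_eq_zero {φ : MvPolynomial (VarIdx r m nn) 𝕂 →+* E} {w : Fin (c + 1) → E}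
    (h : ∀ i, φ (Tmon 𝕂 r m nn l i) = ∑ q, w q * φ (C (A q i))) (t : Fin (r - c)) :
    φ (gPoly 𝕂 r c m hcr nn l A t) = 0 := by
  rw [map_gPoly]
  exact Matrix.det_appendRow_eq_zero fun p ↦ h _

end

variable {n : Fin (r + 1) → ℕ} (l : ∀ i, Fin (n i + 1) → ℕ)
  (A : Matrix (Fin (c + 1)) (Fin (r + 1)) 𝕂)

/-- The ring obtained from `RingAP` by adjoining names for the linear forms in the columns
of `A` that are equal to the monomials `T_i^{l_i}`. -/
abbrev LinearModel (m : ℕ) : Type :=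
  MonomialEqRing (B := MvPolynomial (Fin (c + 1) ⊕ Fin m) 𝕂) l fun i ↦ linearForm (Fin m) (A.col i)

/-- The images of the variables in `LinearModel`. -/
noncomputable def toLinearModelAux (m : ℕ) :
    MvPolynomial (VarIdx r m fun i ↦ n i + 1) 𝕂 →+* LinearModel l A m :=
  eval₂Hom ((algebraMap (MvPolynomial (Fin (c + 1) ⊕ Fin m) 𝕂) _).comp C)
    (Sum.elim (fun x ↦ var _ _ x.1 x.2)
      fun k ↦ algebraMap (MvPolynomial (Fin (c + 1) ⊕ Fin m) 𝕂) _ (X (.inr k)))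

theorem toLinearModelAux_Tmon (i : Fin (r + 1)) :
    toLinearModelAux l A m (Tmon 𝕂 r m _ l i) =
      ∑ q, algebraMap (MvPolynomial (Fin (c + 1) ⊕ Fin m) 𝕂) (LinearModel l A m) (X (.inl q)) *
        toLinearModelAux l A m (C (A q i)) := by
  simp only [Tmon, toLinearModelAux, map_prod, map_pow, eval₂Hom_X', Sum.elim_inl, eval₂Hom_C]
  exact (prod_var_pow l (fun i ↦ linearForm (Fin m) (A.col i)) i).trans (map_linearForm _ _ _)

/-- The map to `LinearModel`; it is an isomorphism when `leftBlock` is invertible. -/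
noncomputable def toLinearModel : RingAP 𝕂 r c m hcr _ l A →+* LinearModel l A m :=
  Ideal.Quotient.lift _ (toLinearModelAux l A m) (fun a ha ↦ by
    rw [← RingHom.mem_ker]
    refine Ideal.span_le.mpr ?_ ha
    rintro _ ⟨t, rfl⟩
    exact map_gPoly_eq_zero (toLinearModelAux_Tmon l A) t)

theorem toLinearModel_mk (x) :
    toLinearModel (hcr := hcr) l A (Ideal.Quotient.mk _ x) = toLinearModelAux l A m x :=
  rfl

variable {A}

theorem nonempty_ringEquiv_linearModel (hA : IsUnit (Matrix.leftBlock hcr A)) :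
    Nonempty (RingAP 𝕂 r c m hcr _ l A ≃+* LinearModel l A m) := by
  obtain ⟨w, hw⟩ := exists_mk_Tmon_eq_sum (m := m) (l := l) hA
  let mk := Ideal.Quotient.mk (Ideal.span (Set.range (gPoly 𝕂 r c m hcr _ l A)))
  let φ : MvPolynomial (Fin (c + 1) ⊕ Fin m) 𝕂 →+* RingAP 𝕂 r c m hcr _ l A :=
    eval₂Hom (mk.comp C) (Sum.elim w fun k ↦ mk (X (.inr k)))
  let ψ : LinearModel l A m →+* RingAP 𝕂 r c m hcr _ l A :=
    lift φ (fun i j ↦ mk (X (.inl ⟨i, j⟩))) fun i ↦ by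
      have := hw i
      simp only [Tmon, map_prod, map_pow] at this
      simp only [map_linearForm, φ, eval₂Hom_C, eval₂Hom_X', Sum.elim_inl]
      exact this
  have hψ (b) : ψ (algebraMap _ _ b) = φ b := lift_algebraMap _ _ _ b
  have hψ' (i j) : ψ (var _ _ i j) = mk (X (.inl ⟨i, j⟩)) := lift_var _ _ _ i j
  have hΦw : (fun q ↦ toLinearModel l A (w q)) = fun q ↦
      algebraMap (MvPolynomial (Fin (c + 1) ⊕ Fin m) 𝕂) (LinearModel l A m) (X (.inl q)) := by
    refine Matrix.eq_of_sum_mul_eq hA ((toLinearModelAux l A m).comp C) fun i ↦ ?_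
    refine Eq.trans ?_ (toLinearModelAux_Tmon l A i)
    rw [← toLinearModel_mk (hcr := hcr), hw, map_sum]
    simp only [map_mul]
    rfl
  have h₁ : ((toLinearModel l A).comp φ) = algebraMap _ (LinearModel l A m) := by
    refine MvPolynomial.ringHom_ext (fun a ↦ ?_) fun x ↦ ?_
    · rw [RingHom.comp_apply, eval₂Hom_C, RingHom.comp_apply, toLinearModel_mk, toLinearModelAux,
        eval₂Hom_C, RingHom.comp_apply]
    · rw [RingHom.comp_apply, eval₂Hom_X']
      cases x with
      | inl q => exact congrFun hΦw q
      | inr k => rw [Sum.elim_inr, toLinearModel_mk, toLinearModelAux, eval₂Hom_X', Sum.elim_inr]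
  refine ⟨.ofRingHom (toLinearModel l A) ψ (ringHom_ext (fun b ↦ ?_) fun i j ↦ ?_)
    (Ideal.Quotient.ringHom_ext (MvPolynomial.ringHom_ext (fun a ↦ ?_) fun x ↦ ?_))⟩
  · rw [RingHom.comp_apply, hψ, ← RingHom.comp_apply, h₁, RingHom.id_apply]
  · rw [RingHom.comp_apply, hψ', toLinearModel_mk, toLinearModelAux, eval₂Hom_X', Sum.elim_inl,
      RingHom.id_apply]
  · rw [RingHom.comp_apply, RingHom.comp_apply, toLinearModel_mk, toLinearModelAux, eval₂Hom_C,
      RingHom.comp_apply, hψ, eval₂Hom_C]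
    rfl
  · rw [RingHom.comp_apply, RingHom.comp_apply, toLinearModel_mk, toLinearModelAux, eval₂Hom_X']
    cases x with
    | inl x => exact hψ' x.1 x.2
    | inr k =>
      rw [Sum.elim_inr, hψ, eval₂Hom_X', Sum.elim_inr]
      rfl

end RingAP

/-- The quotient ring `R = 𝕂[T_{ij},S_k]/⟨g_1,…,g_{r−c}⟩` is a normal
domain: it is an integral domain, integrally closed in its field of fractions. -/
theorem statement_1
    (𝕂 : Type) [Field 𝕂] [IsAlgClosed 𝕂] [CharZero 𝕂]
    (r c m : ℕ) (hc : 0 < c) (hcr : c ≤ r)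
    (nn : Fin (r + 1) → ℕ) (hnn : ∀ i, 0 < nn i)
    (l : ∀ i : Fin (r + 1), Fin (nn i) → ℕ) (hl : ∀ i j, 0 < l i j)
    (A : Matrix (Fin (c + 1)) (Fin (r + 1)) 𝕂)
    (hA : ∀ s : Finset (Fin (r + 1)), s.card = c + 1 →
      LinearIndependent 𝕂 fun j : s => A.transpose (j : Fin (r + 1)))
    :
    IsDomain (RingAP 𝕂 r c m hcr nn l A) ∧
      IsIntegrallyClosed (RingAP 𝕂 r c m hcr nn l A) := by
  obtain ⟨n, rfl⟩ : ∃ n : Fin (r + 1) → ℕ, nn = fun i ↦ n i + 1 :=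
    ⟨fun i ↦ nn i - 1, funext fun i ↦ (Nat.sub_add_cancel (hnn i)).symm⟩
  obtain ⟨e⟩ := RingAP.nonempty_ringEquiv_linearModel (hcr := hcr) (m := m) l
    (Matrix.isUnit_leftBlock hA)
  have hcol {i j : Fin (r + 1)} (hij : i ≠ j) : A.col j ∉ Submodule.span 𝕂 {A.col i} := by
    obtain ⟨s, hs, hcard⟩ := Finset.exists_superset_card_eq (s := {i, j}) (n := c + 1)
      (Finset.card_le_two.trans (by omega)) (by simpa using hcr)
    have hi : i ∈ s := hs (by simp)
    have hj : j ∈ s := hs (by simp)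
    have := (hA s hcard).notMem_span_image (s := {⟨i, hi⟩}) (x := ⟨j, hj⟩)
      (by simpa using hij.symm)
    rwa [Set.image_singleton] at this
  have hcol_ne_zero (i : Fin (r + 1)) : A.col i ≠ 0 := by
    have : Nontrivial (Fin (r + 1)) := Fin.nontrivial_iff_two_le.mpr (by omega)
    obtain ⟨j, hij⟩ := exists_ne i
    intro h
    exact hcol hij (h ▸ Submodule.zero_mem _)
  obtain ⟨_, _⟩ : IsDomain (RingAP.LinearModel l A m) ∧
      IsIntegrallyClosed (RingAP.LinearModel l A m) :=
    MonomialEqRing.isIntegrallyClosed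
      (fun n hn ↦ by
        simpa using (IsUnit.mk0 (n : 𝕂) (by simpa using hn)).map
          (C : 𝕂 →+* MvPolynomial (Fin (c + 1) ⊕ Fin m) 𝕂))
      ((IsAlgClosed.exists_pow_nat_eq (-1 : 𝕂) two_pos).imp' C fun i hi ↦ by
        rw [← map_pow, hi]
        simp)
      (fun i j ↦ (hl i j).ne')
      (fun i ↦ prime_linearForm (Fin m) (hcol_ne_zero i))
      fun i j hij ↦ not_linearForm_dvd (Fin m) (hcol hij)
  exact ⟨e.toMulEquiv.isDomain _, .of_equiv (R := RingAP.LinearModel l A m) e.symm⟩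
end

section
/- The Krull dimension of the quotient ring R = 𝕂[T_{ij},S_k]/⟨g_1,…,g_{r−c}⟩ equals n + m − r + c. -/
open MvPolynomial

/-- Krull dimension is preserved by injective integral ring homomorphisms. -/
theorem ringKrullDim_eq_of_isIntegral_of_injective {R S : Type*} [CommRing R] [CommRing S]
    (f : R →+* S) (hf : f.IsIntegral) (hinj : Function.Injective f) :
    ringKrullDim S = ringKrullDim R := by
  algebraize [f]
  have : FaithfulSMul R S := (faithfulSMul_iff_algebraMap_injective R S).mpr hinj
  refine le_antisymm (Order.krullDim_le_of_strictMono (PrimeSpectrum.comap f) ?_) ?_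
  · intro p q hpq
    exact Ideal.IsIntegral.comap_lt_comap (R := R) hpq
  · refine iSup_le fun p => ?_
    obtain ⟨Q, hQ, hQp⟩ := (Ideal.nonempty_primesOver (S := S) p.head.asIdeal).some
    obtain ⟨L, hL, -⟩ := Ideal.exists_ltSeries_of_hasGoingUp p Q
    rw [← hL]
    exact Order.LTSeries.length_le_krullDim L

/-- A Noether normalization `φ` of a quotient of a polynomial ring determines its dimension; the
injectivity of `φ` modulo `I` is witnessed by a homomorphism `ψ` vanishing on `I`. -/
theorem MvPolynomial.ringKrullDim_quotient_eq_card {K σ τ Ω : Type*} [Field K] [Finite τ]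
    [CommRing Ω] (I : Ideal (MvPolynomial σ K)) (φ : MvPolynomial τ K →ₐ[K] MvPolynomial σ K)
    (hφ : ∀ v, ((Ideal.Quotient.mk I).comp φ.toRingHom).IsIntegralElem
      (Ideal.Quotient.mk I (X v)))
    (ψ : MvPolynomial σ K →+* Ω) (hI : I ≤ RingHom.ker ψ)
    (hψ : Function.Injective (ψ.comp φ.toRingHom)) :
    ringKrullDim (MvPolynomial σ K ⧸ I) = (Nat.card τ : ℕ) := by
  rw [ringKrullDim_eq_of_isIntegral_of_injective ((Ideal.Quotient.mk I).comp φ.toRingHom)]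
  · simp
  · intro x
    obtain ⟨x, rfl⟩ := Ideal.Quotient.mk_surjective x
    induction x using MvPolynomial.induction_on with
    | C a =>
      convert! RingHom.isIntegralElem_map ((Ideal.Quotient.mk I).comp φ.toRingHom) (x := C a)
      simp [← MvPolynomial.algebraMap_eq]
    | add p q hp hq => rw [map_add]; exact hp.add _ hq
    | mul_X p v hp => rw [map_mul]; exact hp.mul _ (hφ v)
  · rw [injective_iff_map_eq_zero] at hψ ⊢
    intro x hx
    exact hψ x (hI (Ideal.Quotient.eq_zero_iff_mem.mp hx))

section Block

variable {K ι T κ μ : Type} [Field K]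

/-- Index type for variables arranged in blocks of sizes `n i`, with free variables `μ`. -/
abbrev BlockVar (n : ι → ℕ) (μ : Type) : Type := (Σ i, Fin (n i)) ⊕ μ

/-- The product of powers of the variables in the block `i`. -/
noncomputable def blockMonomial (K μ : Type) [Field K] {n : ι → ℕ} (l : ∀ i, Fin (n i) → ℕ) (i : ι) :
    MvPolynomial (BlockVar n μ) K :=
  ∏ j, X (Sum.inl ⟨i, j⟩) ^ l i j

/-- A function on the variables with value `x t` on the block `b t` and zero elsewhere. -/
theorem exists_blockFunction {S : Type} [Zero S] (n : ι → ℕ) {b : T → ι}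
    (hb : Function.Injective b) (x : T → S) :
    ∃ z : BlockVar n μ → S, (∀ t j, z (Sum.inl ⟨b t, j⟩) = x t) ∧
      (∀ i, (∀ t, b t ≠ i) → ∀ j, z (Sum.inl ⟨i, j⟩) = 0) ∧ ∀ k, z (Sum.inr k) = 0 := by
  refine ⟨Sum.elim (fun v => Function.extend b x 0 v.1) 0, fun t j => hb.extend_apply _ _ t,
    fun i hi j => Function.extend_apply' _ _ _ fun ⟨t, ht⟩ => hi t ht, fun k => rfl⟩

/-- The polynomial `∏ⱼ (X + yⱼ) ^ lⱼ - q` is monic of positive degree. -/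
theorem monic_prod_X_add_C_pow_sub_C {B : Type} [CommRing B] [Nontrivial B] {n : ℕ} (hn : 0 < n)
    (l : Fin n → ℕ) (hl : ∀ j, 0 < l j) (y : Fin n → B) (q : B) :
    ((∏ j, (Polynomial.X + Polynomial.C (y j)) ^ l j) - Polynomial.C q).Monic ∧
      0 < ((∏ j, (Polynomial.X + Polynomial.C (y j)) ^ l j) - Polynomial.C q).natDegree := by
  have hm : (∏ j, (Polynomial.X + Polynomial.C (y j)) ^ l j).Monic :=
    Polynomial.monic_prod_of_monic _ _ fun j _ => (Polynomial.monic_X_add_C _).pow _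
  have hd : 0 < (∏ j, (Polynomial.X + Polynomial.C (y j)) ^ l j).natDegree := by
    rw [Polynomial.natDegree_prod_of_monic _ _ fun j _ => (Polynomial.monic_X_add_C _).pow _,
      Finset.sum_pos_iff]
    refine ⟨⟨0, hn⟩, Finset.mem_univ _, ?_⟩
    rw [(Polynomial.monic_X_add_C _).natDegree_pow, Polynomial.natDegree_X_add_C]
    simpa using hl _
  have hlt : (Polynomial.C q).degree < (∏ j, (Polynomial.X + Polynomial.C (y j)) ^ l j).degree :=
    Polynomial.degree_C_le.trans_lt (Polynomial.natDegree_pos_iff_degree_pos.mp hd)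
  exact ⟨hm.sub_of_left hlt, by rwa [Polynomial.natDegree_sub_C]⟩

/-- Relations expressing the monomials of the blocks `b t` linearly through the monomials of
other blocks `col k` cut the dimension down by one each. -/
theorem ringKrullDim_quotient_blockMonomial_relations
    [Fintype ι] [Fintype T] [Fintype κ] [Fintype μ] (n : ι → ℕ) (hn : ∀ i, 0 < n i)
    (l : ∀ i, Fin (n i) → ℕ) (hl : ∀ i j, 0 < l i j) (b : T → ι) (hb : Function.Injective b)
    (col : κ → ι) (hcol : ∀ k t, b t ≠ col k) (a : T → κ → K) :
    ringKrullDim (MvPolynomial (BlockVar n μ) K ⧸ Ideal.span (Set.range fun t : T =>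
      blockMonomial K μ l (b t) - ∑ k, C (a t k) * blockMonomial K μ l (col k))) =
      ((∑ i, n i) + Fintype.card μ - Fintype.card T : ℕ) := by
  classical
  let piv : T → BlockVar n μ := fun t => Sum.inl ⟨b t, ⟨0, hn _⟩⟩
  have hpiv : Function.Injective piv := fun s t h =>
    hb (congrArg Sigma.fst (Sum.inl_injective h))
  obtain ⟨N, hN⟩ : ∃ N : Set (BlockVar n μ), N = (Set.range piv)ᶜ := ⟨_, rfl⟩
  have hcard : Nat.card N = (∑ i, n i) + Fintype.card μ - Fintype.card T := by
    rw [hN, Nat.card_eq_fintype_card, Fintype.card_compl_set, Set.card_range_of_injective hpiv]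
    simp
  rw [← hcard]
  set I := Ideal.span (Set.range fun t : T =>
      blockMonomial K μ l (b t) - ∑ k, C (a t k) * blockMonomial K μ l (col k)) with hI
  obtain ⟨y, y_piv, y_N⟩ : ∃ y : BlockVar n μ → MvPolynomial N K,
      (∀ t, y (piv t) = 0) ∧ ∀ v : N, y v = X v := by
    refine ⟨fun v => if h : v ∈ N then X ⟨v, h⟩ else 0, fun t => dif_neg ?_, fun v => dif_pos v.2⟩
    simp [hN]
  obtain ⟨z, z_b, z_other, z_free⟩ :=
    exists_blockFunction (μ := μ) n hb fun t => (X (piv t) : MvPolynomial (BlockVar n μ) K)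
  let φ : MvPolynomial N K →ₐ[K] MvPolynomial (BlockVar n μ) K := aeval fun v => X v.1 - z v.1
  have φ_y (v) : φ (y v) = X v - z v := by
    by_cases h : v ∈ N
    · rw [y_N ⟨v, h⟩]
      exact aeval_X _ _
    · obtain ⟨t, rfl⟩ : v ∈ Set.range piv := by simpa [hN] using h
      rw [y_piv, map_zero, z_b, sub_self]
  let P : T → Polynomial (MvPolynomial N K) := fun t =>
    (∏ j, (Polynomial.X + Polynomial.C (y (Sum.inl ⟨b t, j⟩))) ^ l (b t) j) -
      Polynomial.C (∑ k, C (a t k) * ∏ j, y (Sum.inl ⟨col k, j⟩) ^ l (col k) j)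
  have P_monic (t) := monic_prod_X_add_C_pow_sub_C (hn (b t)) (l (b t)) (hl (b t))
    (fun j => y (Sum.inl ⟨b t, j⟩)) (∑ k, C (a t k) * ∏ j, y (Sum.inl ⟨col k, j⟩) ^ l (col k) j)
  have eval_P {S : Type} [CommRing S] (g : MvPolynomial N K →+* S) (x : S) (t) :
      (P t).eval₂ g x = (∏ j, (x + g (y (Sum.inl ⟨b t, j⟩))) ^ l (b t) j) -
        ∑ k, g (C (a t k)) * ∏ j, g (y (Sum.inl ⟨col k, j⟩)) ^ l (col k) j := by
    rw [Polynomial.eval₂_sub, Polynomial.eval₂_C]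
    simp [Polynomial.eval₂_finsetProd, Polynomial.eval₂_pow]
  have int_piv (t) : ((Ideal.Quotient.mk I).comp φ.toRingHom).IsIntegralElem
      (Ideal.Quotient.mk I (X (piv t))) := by
    refine ⟨P t, (P_monic t).1, ?_⟩
    rw [← Polynomial.hom_eval₂, Ideal.Quotient.eq_zero_iff_mem]
    apply Ideal.subset_span
    refine ⟨t, ?_⟩
    rw [eval_P]
    simp only [AlgHom.toRingHom_eq_coe, RingHom.coe_coe, φ_y, z_b, add_sub_cancel,
      z_other _ (hcol _), sub_zero, blockMonomial, algHom_C, algebraMap_eq]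
  let Ω := AlgebraicClosure (FractionRing (MvPolynomial N K))
  let f : MvPolynomial N K →+* Ω :=
    (algebraMap (FractionRing (MvPolynomial N K)) Ω).comp (algebraMap _ _)
  have f_inj : Function.Injective f :=
    (algebraMap (FractionRing (MvPolynomial N K)) Ω).injective.comp
      (IsFractionRing.injective _ _)
  have root (t) : ∃ x : Ω, (P t).eval₂ f x = 0 := by
    refine IsAlgClosed.exists_eval₂_eq_zero_of_injective f f_inj (P t) ?_
    exact (Polynomial.natDegree_pos_iff_degree_pos.mp (P_monic t).2).ne'
  choose ζ hζ using root
  obtain ⟨w, w_b, w_other, w_free⟩ := exists_blockFunction (μ := μ) n hb ζ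
  let ψ : MvPolynomial (BlockVar n μ) K →+* Ω := eval₂Hom (f.comp C) fun v => f (y v) + w v
  have ψ_C (x) : ψ (C x) = f (C x) := eval₂Hom_C _ _ _
  have ψ_X (v) : ψ (X v) = f (y v) + w v := eval₂Hom_X' _ _ _
  have ψ_z (v) : ψ (z v) = w v := by
    obtain ⟨i, j⟩ | k := v
    · by_cases h : ∃ t, b t = i
      · obtain ⟨t, rfl⟩ := h
        rw [z_b, w_b, ψ_X, y_piv, map_zero, zero_add, w_b]
      · have h' : ∀ t, b t ≠ i := not_exists.mp h
        rw [z_other i h', w_other i h', map_zero]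
    · rw [z_free, w_free, map_zero]
  refine MvPolynomial.ringKrullDim_quotient_eq_card I φ (fun v => ?_) ψ ?_ ?_
  · have hz : ((Ideal.Quotient.mk I).comp φ.toRingHom).IsIntegralElem
        (Ideal.Quotient.mk I (z v)) := by
      obtain ⟨i, j⟩ | k := v
      · by_cases h : ∃ t, b t = i
        · obtain ⟨t, rfl⟩ := h
          rw [z_b]
          exact int_piv t
        · rw [z_other i (not_exists.mp h), map_zero]
          exact RingHom.isIntegralElem_zero _
      · rw [z_free, map_zero]
        exact RingHom.isIntegralElem_zero _
    have hy := RingHom.isIntegralElem_map ((Ideal.Quotient.mk I).comp φ.toRingHom) (x := y v)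
    have hX : Ideal.Quotient.mk I (X v) =
        (Ideal.Quotient.mk I).comp φ.toRingHom (y v) + Ideal.Quotient.mk I (z v) := by
      change _ = Ideal.Quotient.mk I (φ (y v)) + _
      rw [φ_y, ← map_add, sub_add_cancel]
    rw [hX]
    exact hy.add _ hz
  · rw [hI, Ideal.span_le]
    rintro _ ⟨t, rfl⟩
    rw [SetLike.mem_coe, RingHom.mem_ker, ← hζ t, eval_P]
    simp only [blockMonomial, map_sub, map_prod, map_sum, map_mul, map_pow, ψ_C, ψ_X, w_b,
      w_other _ (hcol _), add_zero, add_comm (ζ t)]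
  · suffices ψ.comp φ.toRingHom = f by rwa [this]
    refine MvPolynomial.ringHom_ext (fun x => ?_) fun v => ?_
    · change ψ (φ (C x)) = _
      rw [algHom_C, algebraMap_eq, ψ_C]
    · change ψ (φ (X v)) = _
      rw [← y_N, φ_y, map_sub, ψ_X, ψ_z, add_sub_cancel_right]

end Block

/-- Expanding `g_t` along its last row solves it for the monomial `T_{c+t}^{l_{c+t}}`. -/
theorem gPoly_eq_s2 (𝕂 : Type) [Field 𝕂] (r c m : ℕ) (hcr : c ≤ r) (nn : Fin (r + 1) → ℕ)
    (l : ∀ i : Fin (r + 1), Fin (nn i) → ℕ) (A : Matrix (Fin (c + 1)) (Fin (r + 1)) 𝕂)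
    (hA : (A.submatrix id (Fin.castLE (by omega : c + 1 ≤ r + 1))).det ≠ 0) (t : Fin (r - c)) :
    ∃ (d : 𝕂) (a : Fin (c + 1) → 𝕂), d ≠ 0 ∧ gPoly 𝕂 r c m hcr nn l A t =
      C d * (Tmon 𝕂 r m nn l ⟨c + 1 + t, by omega⟩ -
        ∑ k, C (a k) * Tmon 𝕂 r m nn l (Fin.castLE (by omega) k)) := by
  set d := (A.submatrix id (Fin.castLE (by omega : c + 1 ≤ r + 1))).det with hd
  let M (p : Fin (c + 2)) :=
    (A.submatrix id fun k : Fin (c + 1) => colOf r c hcr t (p.succAbove k)).det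
  refine ⟨d, fun k => - d⁻¹ * ((-1) ^ (c + 1 + (k : ℕ)) * M k.castSucc), hA, ?_⟩
  have hlast : M (Fin.last _) = d := by
    simp only [M, hd]
    congr! 3 with k
    ext
    simp [colOf, Nat.lt_succ_iff.mp k.isLt]
  have hcol (k : Fin (c + 1)) : colOf r c hcr t k.castSucc = Fin.castLE (by omega) k := by
    ext
    simp [colOf, Nat.lt_succ_iff.mp k.isLt]
  have hcol' : colOf r c hcr t (Fin.last _) = ⟨c + 1 + t, by omega⟩ := by
    ext
    simp [colOf]
  have hminor (p : Fin (c + 2)) : Matrix.det (Matrix.submatrix (Matrix.of fun q p : Fin (c + 2) =>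
      if h : (q : ℕ) < c + 1 then C (A ⟨q, h⟩ (colOf r c hcr t p))
      else Tmon 𝕂 r m nn l (colOf r c hcr t p)) (Fin.last _).succAbove p.succAbove) = C (M p) := by
    simp only [M]
    rw [RingHom.map_det]
    congr 1
    ext1 q k
    simp only [Matrix.submatrix_apply, Matrix.of_apply, Fin.succAbove_last, Fin.val_castSucc,
      q.isLt, dite_true, RingHom.mapMatrix_apply, Matrix.map_apply, id]
  rw [gPoly, Matrix.det_succ_row _ (Fin.last _), Fin.sum_univ_castSucc]
  simp only [hminor, hlast]
  simp only [Matrix.of_apply, Fin.val_last, lt_irrefl, dite_false, hcol, hcol']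
  rw [mul_sub, Finset.mul_sum, sub_eq_add_neg, add_comm, ← Finset.sum_neg_distrib]
  congr 1
  · rw [← two_mul, pow_mul]
    simp [mul_comm]
  · refine Finset.sum_congr rfl fun k _ => ?_
    have hC : (C d : MvPolynomial (VarIdx r m nn) 𝕂) * C d⁻¹ = 1 := by
      rw [← C_mul, mul_inv_cancel₀ hA, C_1]
    simp only [C_mul, C_neg, C_pow, C_1, Fin.val_castSucc]
    linear_combination (-(-1) ^ (c + 1 + (k : ℕ)) * C (M k.castSucc) *
      Tmon 𝕂 r m nn l (Fin.castLE (by omega) k)) * hC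

/-- The Krull dimension of `R = 𝕂[T_{ij},S_k]/⟨g_1,…,g_{r−c}⟩`
equals `n + m − r + c` where `n = n_0 + ⋯ + n_r`. -/
theorem statement_2
    (𝕂 : Type) [Field 𝕂] [IsAlgClosed 𝕂] [CharZero 𝕂]
    (r c m : ℕ) (hc : 0 < c) (hcr : c ≤ r)
    (nn : Fin (r + 1) → ℕ) (hnn : ∀ i, 0 < nn i)
    (l : ∀ i : Fin (r + 1), Fin (nn i) → ℕ) (hl : ∀ i j, 0 < l i j)
    (A : Matrix (Fin (c + 1)) (Fin (r + 1)) 𝕂)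
    (hA : ∀ s : Finset (Fin (r + 1)), s.card = c + 1 →
      LinearIndependent 𝕂 fun j : s => A.transpose (j : Fin (r + 1)))
    :
    ringKrullDim (RingAP 𝕂 r c m hcr nn l A) =
      (((∑ i, nn i) + m - r + c : ℕ) : WithBot (WithTop ℕ)) := by
  have hdet : (A.submatrix id (Fin.castLE (by omega : c + 1 ≤ r + 1))).det ≠ 0 := by
    have hinj : Function.Injective (Fin.castLE (by omega : c + 1 ≤ r + 1)) :=
      Fin.castLE_injective _
    have h := hA (Finset.univ.map ⟨_, hinj⟩) (by simp)
    have h' := h.comp (fun k : Fin (c + 1) => ⟨Fin.castLE (by omega : c + 1 ≤ r + 1) k, by simp⟩)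
      fun _ _ hk => hinj (Subtype.ext_iff.mp hk)
    rw [← isUnit_iff_ne_zero, ← Matrix.isUnit_iff_isUnit_det,
      ← Matrix.linearIndependent_cols_iff_isUnit]
    exact h'
  choose d a hd hg using gPoly_eq_s2 𝕂 r c m hcr nn l A hdet
  have hspan : Ideal.span (Set.range (gPoly 𝕂 r c m hcr nn l A)) =
      Ideal.span (Set.range fun t : Fin (r - c) => Tmon 𝕂 r m nn l ⟨c + 1 + t, by omega⟩ -
        ∑ k, C (a t k) * Tmon 𝕂 r m nn l (Fin.castLE (by omega) k)) := by
    rw [Ideal.span_range_eq_iSup, Ideal.span_range_eq_iSup]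
    refine iSup_congr fun t => ?_
    rw [hg, Ideal.span_singleton_mul_left_unit ((isUnit_iff_ne_zero.mpr (hd t)).map C)]
  have hsum : r + 1 ≤ ∑ i, nn i := by
    simpa using Finset.card_nsmul_le_sum Finset.univ nn 1 fun i _ => hnn i
  have key := ringKrullDim_quotient_blockMonomial_relations (K := 𝕂) (μ := Fin m) nn hnn l hl
    (fun t : Fin (r - c) => ⟨c + 1 + t, by omega⟩)
    (fun s t h => by simpa [Fin.ext_iff] using h)
    (fun k : Fin (c + 1) => Fin.castLE (by omega : c + 1 ≤ r + 1) k)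
    (fun k t h => by simp [Fin.ext_iff] at h; omega) a
  rw [ringKrullDim_eq_of_ringEquiv (Ideal.quotEquivOfEq hspan)]
  refine key.trans ?_
  congr 2
  simp
  omega
end

section
/- Every unit of the quotient ring R = 𝕂[T_{ij},S_k]/⟨g_1,…,g_{r−c}⟩ is constant: if u is a unit of R, then u is the image of a nonzero element of 𝕂 under the structure map 𝕂 → R. -/
open MvPolynomial

section ReducedMonomials

variable {ι : Type*} {κ : ι → Type*} [∀ i, Fintype (κ i)]

/-- The exponents `μ` whose monomial is not divisible by any of the monomials `T_i^{l_i}`. -/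
def reducedExponents (l : (Σ i, κ i) → ℕ) : Set ((Σ i, κ i) →₀ ℕ) :=
  {μ | ∀ i, ∃ j, μ ⟨i, j⟩ < l ⟨i, j⟩}

/-- The subgroup of the torus `(Fˣ)^σ` on which all monomials `T_i^{l_i}` equal one. -/
def blockKernel (F : Type*) [Field F] (l : (Σ i, κ i) → ℕ) : Subgroup ((Σ i, κ i) → Fˣ) where
  carrier := {t | ∀ i, ∏ j, t ⟨i, j⟩ ^ l ⟨i, j⟩ = 1}
  one_mem' := by simp
  mul_mem' := by
    intro s t hs ht i
    simp only [Pi.mul_apply, mul_pow, Finset.prod_mul_distrib, hs i, ht i, mul_one]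
  inv_mem' := by
    intro t ht i
    simp only [Pi.inv_apply, inv_pow, Finset.prod_inv_distrib, ht i, inv_one]

theorem prod_block_mulSingle_pow {M : Type*} [CommMonoid M] [DecidableEq (Σ i, κ i)]
    (i : ι) (j : κ i) (x : M) (l : (Σ i, κ i) → ℕ) (k : ι) [Decidable (k = i)] :
    ∏ j', (Pi.mulSingle ⟨i, j⟩ x : (Σ i, κ i) → M) ⟨k, j'⟩ ^ l ⟨k, j'⟩ =
      if k = i then x ^ l ⟨i, j⟩ else 1 := by
  classical
  split_ifs with h
  · subst h
    rw [Finset.prod_eq_single j]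
    · simp
    · intro b _ hb
      rw [Pi.mulSingle_eq_of_ne (by simpa using hb), one_pow]
    · simp
  · refine Finset.prod_eq_one fun b _ => ?_
    rw [Pi.mulSingle_eq_of_ne (by simp [h]), one_pow]

variable {B : Type*} [CommRing B]

/-- The ideal generated by the relations `T_i^{l_i} = f_i`. -/
noncomputable def blockIdeal (l : (Σ i, κ i) → ℕ) (f : ι → B) : Ideal (MvPolynomial (Σ i, κ i) B) :=
  Ideal.span (Set.range fun i => ∏ j, X ⟨i, j⟩ ^ l ⟨i, j⟩ - C (f i))

theorem exists_reduced_sub_mem (l : (Σ i, κ i) → ℕ) (hl : ∀ v, 0 < l v) [∀ i, Nonempty (κ i)]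
    (f : ι → B) (p : MvPolynomial (Σ i, κ i) B) :
    ∃ q, (q.support : Set _) ⊆ reducedExponents l ∧ p - q ∈ blockIdeal l f := by
  classical
  suffices h : (p : MvPolynomial (Σ i, κ i) B) ∈ restrictSupport B (reducedExponents l) ⊔
      (blockIdeal l f).restrictScalars B by
    obtain ⟨q, hq, s, hs, rfl⟩ := Submodule.mem_sup.mp h
    refine ⟨q, hq, ?_⟩
    simpa using hs
  have hmon : ∀ n, ∀ μ : (Σ i, κ i) →₀ ℕ, μ.degree = n → ∀ b : B, monomial μ b ∈
      restrictSupport B (reducedExponents l) ⊔ (blockIdeal l f).restrictScalars B := by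
    intro n
    induction n using Nat.strong_induction_on with
    | _ n ih =>
      rintro μ rfl b
      by_cases hμ : μ ∈ reducedExponents l
      · refine Submodule.mem_sup_left ?_
        intro ν hν
        have := support_monomial_subset hν
        rw [Finset.mem_singleton] at this
        rwa [this]
      · obtain ⟨i, hi⟩ : ∃ i, ∀ j, l ⟨i, j⟩ ≤ μ ⟨i, j⟩ := by
          simpa [reducedExponents] using hμ
        set e : (Σ i, κ i) →₀ ℕ := ∑ j, Finsupp.single ⟨i, j⟩ (l ⟨i, j⟩) with he
        have he_apply : ∀ j, e ⟨i, j⟩ = l ⟨i, j⟩ := by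
          intro j
          rw [he, Finsupp.finsetSum_apply, Finset.sum_eq_single j]
          · simp
          · intro b _ hb
            rw [Finsupp.single_eq_of_ne (by simpa using hb.symm)]
          · simp
        have hle : e ≤ μ := by
          rintro ⟨k, j⟩
          by_cases hk : k = i
          · subst hk
            rw [he_apply]
            exact hi j
          · have : e ⟨k, j⟩ = 0 := by
              rw [he, Finsupp.finsetSum_apply]
              refine Finset.sum_eq_zero fun j' _ => ?_
              rw [Finsupp.single_eq_of_ne (by simp [hk])]
            omega
        obtain ⟨ν, rfl⟩ := exists_add_of_le hle
        have hprod : (∏ j, X ⟨i, j⟩ ^ l ⟨i, j⟩ : MvPolynomial (Σ i, κ i) B) = monomial e 1 := by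
          simp only [X_pow_eq_monomial, he]
          rw [← monomial_sum_one]
        have hdeg : ν.degree < (e + ν).degree := by
          obtain ⟨j⟩ := ‹∀ i, Nonempty (κ i)› i
          have h1 : e ⟨i, j⟩ ≤ e.degree := Finsupp.le_degree _ _
          have h2 := hl ⟨i, j⟩
          rw [map_add]
          rw [he_apply] at h1
          omega
        have hsplit : monomial (e + ν) b = monomial ν (f i * b) +
            (∏ j, X ⟨i, j⟩ ^ l ⟨i, j⟩ - C (f i)) * monomial ν b := by
          rw [hprod, sub_mul, monomial_mul, C_mul_monomial, one_mul]
          ring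
        rw [hsplit]
        refine add_mem (ih _ hdeg ν rfl _) (Submodule.mem_sup_right ?_)
        exact Ideal.mul_mem_right _ _ (Ideal.subset_span ⟨i, rfl⟩)
  rw [p.as_sum]
  exact sum_mem fun μ _ => hmon _ μ rfl _

variable [Fintype ι] {F : Type*} [Field F]

/-- The character of `blockKernel F l` given by the monomial with exponent `μ`. -/
noncomputable def monomialChar (l : (Σ i, κ i) → ℕ) (μ : (Σ i, κ i) →₀ ℕ) :
    blockKernel F l →* F where
  toFun t := ((∏ v, (t : (Σ i, κ i) → Fˣ) v ^ μ v : Fˣ) : F)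
  map_one' := by simp
  map_mul' s t := by simp [mul_pow, Finset.prod_mul_distrib]

theorem two_pow_zpow_injective [CharZero F] :
    Function.Injective fun n : ℤ => (Units.mk0 (2 : F) two_ne_zero) ^ n := by
  rw [injective_zpow_iff_not_isOfFinOrder, ← Units.isOfFinOrder_val, isOfFinOrder_iff_pow_eq_one]
  rintro ⟨n, hn, h⟩
  have h' : (2 : ℕ) ^ n = 1 := by
    have : ((2 ^ n : ℕ) : F) = ((1 : ℕ) : F) := by simpa using h
    exact_mod_cast this
  have := Nat.one_lt_two_pow hn.ne'
  omega

theorem prod_mulSingle_pow {σ M : Type*} [Fintype σ] [DecidableEq σ] [CommMonoid M]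
    (a : σ) (x : M) (e : σ → ℕ) :
    ∏ v, (Pi.mulSingle a x : σ → M) v ^ e v = x ^ e a := by
  rw [Finset.prod_eq_single a]
  · simp
  · intro b _ hb
    simp [Pi.mulSingle_eq_of_ne hb]
  · simp

theorem dvd_sub_of_monomialChar_eq [IsAlgClosed F] [CharZero F] {l : (Σ i, κ i) → ℕ}
    (hl : ∀ v, 0 < l v) {μ ν : (Σ i, κ i) →₀ ℕ}
    (h : monomialChar (F := F) l μ = monomialChar l ν) (v : Σ i, κ i) :
    (l v : ℤ) ∣ μ v - ν v := by
  classical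
  obtain ⟨i, j⟩ := v
  have : NeZero (l ⟨i, j⟩ : F) := ⟨by exact_mod_cast (hl _).ne'⟩
  obtain ⟨ζ, hζ⟩ := HasEnoughRootsOfUnity.exists_primitiveRoot F (l ⟨i, j⟩)
  have hu := hζ.isUnit (hl _).ne'
  obtain ⟨z, rfl⟩ := hu
  rw [IsPrimitiveRoot.coe_units_iff] at hζ
  have hmem : Pi.mulSingle ⟨i, j⟩ z ∈ blockKernel F l := by
    intro k
    rw [prod_block_mulSingle_pow]
    split_ifs
    · exact hζ.pow_eq_one
    · rfl
  have h1 := Units.ext (DFunLike.congr_fun h ⟨_, hmem⟩)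
  simp only [prod_mulSingle_pow] at h1
  rw [pow_eq_pow_iff_modEq, ← hζ.eq_orderOf] at h1
  exact (Nat.modEq_iff_dvd.mp h1.symm)

theorem cross_mul_eq_of_monomialChar_eq [CharZero F] {l : (Σ i, κ i) → ℕ}
    {μ ν : (Σ i, κ i) →₀ ℕ}
    (h : monomialChar (F := F) l μ = monomialChar l ν) (i : ι) (j j' : κ i) :
    (l ⟨i, j'⟩ : ℤ) * (μ ⟨i, j⟩ - ν ⟨i, j⟩) = l ⟨i, j⟩ * (μ ⟨i, j'⟩ - ν ⟨i, j'⟩) := by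
  classical
  set z : Fˣ := Units.mk0 (2 : F) two_ne_zero
  have hmem : (Pi.mulSingle ⟨i, j⟩ (z ^ (l ⟨i, j'⟩ : ℤ)) *
      Pi.mulSingle ⟨i, j'⟩ (z ^ (-l ⟨i, j⟩ : ℤ)) : (Σ i, κ i) → Fˣ) ∈ blockKernel F l := by
    intro k
    simp only [Pi.mul_apply, mul_pow, Finset.prod_mul_distrib]
    rw [prod_block_mulSingle_pow, prod_block_mulSingle_pow]
    split_ifs
    · rw [← zpow_natCast, ← zpow_natCast, ← zpow_mul, ← zpow_mul, ← zpow_add]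
      convert zpow_zero z using 2
      ring
    · simp
  have h1 := Units.ext (DFunLike.congr_fun h ⟨_, hmem⟩)
  simp only [Pi.mul_apply, mul_pow, Finset.prod_mul_distrib, prod_mulSingle_pow] at h1
  simp only [← zpow_natCast, ← zpow_mul, ← zpow_add] at h1
  have h2 := two_pow_zpow_injective h1
  linarith

theorem injOn_monomialChar [IsAlgClosed F] [CharZero F] {l : (Σ i, κ i) → ℕ}
    (hl : ∀ v, 0 < l v) :
    Set.InjOn (monomialChar (F := F) l) (reducedExponents l) := by
  have key : ∀ μ ∈ reducedExponents l, ∀ ν ∈ reducedExponents l,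
      monomialChar (F := F) l μ = monomialChar l ν → ∀ v, μ v ≤ ν v := by
    rintro μ hμ ν hν h ⟨i, j⟩
    obtain ⟨j', hj'⟩ := hμ i
    obtain ⟨q, hq⟩ := dvd_sub_of_monomialChar_eq hl h ⟨i, j'⟩
    have hc := cross_mul_eq_of_monomialChar_eq h i j j'
    have hpos := hl ⟨i, j⟩
    have hpos' := hl ⟨i, j'⟩
    have hq0 : q ≤ 0 := by
      by_contra! hlt
      have : (l ⟨i, j'⟩ : ℤ) ≤ l ⟨i, j'⟩ * q := by nlinarith
      omega
    have h3 : (l ⟨i, j'⟩ : ℤ) * (μ ⟨i, j⟩ - ν ⟨i, j⟩) ≤ 0 := by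
      rw [hc, hq]
      exact mul_nonpos_of_nonneg_of_nonpos (by positivity)
        (mul_nonpos_of_nonneg_of_nonpos (by positivity) hq0)
    have h4 : (μ ⟨i, j⟩ - ν ⟨i, j⟩ : ℤ) ≤ 0 := by
      by_contra! hlt
      have := mul_pos (Int.natCast_pos.mpr hpos') hlt
      omega
    omega
  intro μ hμ ν hν h
  ext v
  exact le_antisymm (key μ hμ ν hν h v) (key ν hν μ hμ h.symm v)

theorem linearIndepOn_monomialChar [IsAlgClosed F] [CharZero F] {l : (Σ i, κ i) → ℕ}
    (hl : ∀ v, 0 < l v) :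
    LinearIndepOn F (fun μ => (monomialChar (F := F) l μ : blockKernel F l → F))
      (reducedExponents l) :=
  (linearIndependent_monoidHom (blockKernel F l) F).comp
    (fun μ : reducedExponents l => monomialChar (F := F) l μ)
    (injOn_monomialChar hl).injective

theorem eq_zero_of_forall_aeval_eq_zero [IsAlgClosed F] [CharZero F] [Algebra B F]
    [FaithfulSMul B F] {l : (Σ i, κ i) → ℕ} (hl : ∀ v, 0 < l v) [∀ i, Nonempty (κ i)]
    {f : ι → B} (hf : ∀ i, f i ≠ 0) {p : MvPolynomial (Σ i, κ i) B}
    (hp : (p.support : Set _) ⊆ reducedExponents l)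
    (h : ∀ y : (Σ i, κ i) → F, (∀ i, ∏ j, y ⟨i, j⟩ ^ l ⟨i, j⟩ = algebraMap B F (f i)) →
      aeval y p = 0) : p = 0 := by
  classical
  have hinj := FaithfulSMul.algebraMap_injective B F
  have hroot : ∀ i, ∃ x : κ i → F, ∏ j, x j ^ l ⟨i, j⟩ = algebraMap B F (f i) := by
    intro i
    obtain ⟨j⟩ := ‹∀ i, Nonempty (κ i)› i
    obtain ⟨z, hz⟩ := IsAlgClosed.exists_pow_nat_eq (algebraMap B F (f i)) (hl ⟨i, j⟩)
    refine ⟨Pi.mulSingle j z, ?_⟩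
    rw [prod_mulSingle_pow j z fun j => l ⟨i, j⟩, hz]
  choose x hx using hroot
  have hx0 : ∀ i j, x i j ≠ 0 := by
    intro i j h0
    have h1 := hx i
    rw [Finset.prod_eq_zero (Finset.mem_univ j) (by rw [h0, zero_pow (hl _).ne'])] at h1
    exact hf i (hinj (by rw [← h1, map_zero]))
  have hsum := linearIndepOn_iff'.mp (linearIndepOn_monomialChar (F := F) hl) p.support
    (fun μ => algebraMap B F (p.coeff μ) * ∏ v, x v.1 v.2 ^ μ v) hp (by
      ext t
      have ht := h (fun v => x v.1 v.2 * (t : (Σ i, κ i) → Fˣ) v) (by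
        intro i
        have := congrArg (Units.val) (t.2 i)
        push_cast at this
        simp only [mul_pow, Finset.prod_mul_distrib, hx, this, mul_one])
      rw [aeval_def, eval₂_eq'] at ht
      simpa [monomialChar, mul_pow, Finset.prod_mul_distrib, mul_assoc] using ht)
  ext μ
  by_contra hμ
  rw [coeff_zero] at hμ
  have h1 := hsum μ (mem_support_iff.mpr hμ)
  refine mul_ne_zero ?_ ?_ h1
  · rwa [Ne, map_eq_zero_iff _ hinj]
  · exact Finset.prod_ne_zero_iff.mpr fun v _ => pow_ne_zero _ (hx0 _ _)

theorem isRadical_blockIdeal [IsDomain B] [CharZero B] {l : (Σ i, κ i) → ℕ}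
    (hl : ∀ v, 0 < l v) [∀ i, Nonempty (κ i)] {f : ι → B} (hf : ∀ i, f i ≠ 0) :
    (blockIdeal l f).IsRadical := by
  intro p hp
  obtain ⟨q, hq, hpq⟩ := exists_reduced_sub_mem l hl f p
  have : FaithfulSMul B (AlgebraicClosure (FractionRing B)) :=
    FaithfulSMul.trans B (FractionRing B) _
  have hq0 : q = 0 := by
    refine eq_zero_of_forall_aeval_eq_zero (F := AlgebraicClosure (FractionRing B)) hl hf hq ?_
    intro y hy
    have hker : blockIdeal l f ≤ RingHom.ker (aeval y : MvPolynomial (Σ i, κ i) B →ₐ[B] _) := by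
      refine Ideal.span_le.mpr ?_
      rintro _ ⟨i, rfl⟩
      simp [hy]
    obtain ⟨n, hn⟩ := hp
    have h1 := hker hn
    rw [RingHom.mem_ker, map_pow] at h1
    have h2 := hker hpq
    rw [RingHom.mem_ker, map_sub, eq_zero_of_pow_eq_zero h1, zero_sub, neg_eq_zero] at h2
    exact h2
  simpa [hq0] using hpq

end ReducedMonomials

section ArrangementRing

variable {𝕂 : Type} [Field 𝕂] {r c m : ℕ} {hcr : c ≤ r} {nn : Fin (r + 1) → ℕ}
  {l : ∀ i : Fin (r + 1), Fin (nn i) → ℕ} {A : Matrix (Fin (c + 1)) (Fin (r + 1)) 𝕂}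

theorem colOf_injective (t : Fin (r - c)) : Function.Injective (colOf r c hcr t) := by
  intro p q h
  have hp := p.isLt
  have hq := q.isLt
  unfold colOf at h
  split_ifs at h <;> simp only [Fin.mk.injEq] at h <;> ext <;> omega

/-- The coefficient of the `p`-th monomial in `gPoly`: a signed maximal minor of `A`. -/
def gCoeff (hcr : c ≤ r) (A : Matrix (Fin (c + 1)) (Fin (r + 1)) 𝕂) (t : Fin (r - c))
    (p : Fin (c + 2)) : 𝕂 :=
  (-1) ^ (c + 1 + p : ℕ) * (A.submatrix id (colOf r c hcr t ∘ p.succAbove)).det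

theorem gPoly_eq_sum (t : Fin (r - c)) :
    gPoly 𝕂 r c m hcr nn l A t =
      ∑ p, C (gCoeff hcr A t p) * Tmon 𝕂 r m nn l (colOf r c hcr t p) := by
  rw [gPoly, Matrix.det_succ_row _ (Fin.last (c + 1))]
  refine Finset.sum_congr rfl fun p _ => ?_
  have hminor : (Matrix.of fun q p : Fin (c + 2) =>
      if h : (q : ℕ) < c + 1 then C (A ⟨q, h⟩ (colOf r c hcr t p))
      else Tmon 𝕂 r m nn l (colOf r c hcr t p)).submatrix
        (Fin.last (c + 1)).succAbove p.succAbove =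
      (C : 𝕂 →+* MvPolynomial (VarIdx r m nn) 𝕂).mapMatrix
        (A.submatrix id (colOf r c hcr t ∘ p.succAbove)) := by
    ext1 q p
    simp [q.is_le]
  rw [hminor, ← RingHom.map_det, gCoeff]
  simp only [Matrix.of_apply, Fin.val_last, lt_irrefl, dite_false, map_mul, map_pow, map_neg,
    map_one]
  ring

theorem gCoeff_ne_zero
    (hA : ∀ s : Finset (Fin (r + 1)), s.card = c + 1 →
      LinearIndependent 𝕂 fun j : s => A.transpose (j : Fin (r + 1)))
    (t : Fin (r - c)) (p : Fin (c + 2)) : gCoeff hcr A t p ≠ 0 := by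
  have hinj : Function.Injective (colOf r c hcr t ∘ p.succAbove) :=
    (colOf_injective t).comp Fin.succAbove_right_injective
  have hli := hA (Finset.univ.image (colOf r c hcr t ∘ p.succAbove))
    (by rw [Finset.card_image_of_injective _ hinj, Finset.card_univ, Fintype.card_fin])
  have hli' := hli.comp
    (fun q => ⟨(colOf r c hcr t ∘ p.succAbove) q, Finset.mem_image_of_mem _ (Finset.mem_univ q)⟩)
    (fun q q' h => hinj (congrArg Subtype.val h))
  have hunit : IsUnit (A.submatrix id (colOf r c hcr t ∘ p.succAbove)) :=
    Matrix.linearIndependent_cols_iff_isUnit.mp hli'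
  refine mul_ne_zero (pow_ne_zero _ (neg_ne_zero.mpr one_ne_zero)) ?_
  exact ((Matrix.isUnit_iff_isUnit_det _).mp hunit).ne_zero

/-- The splitting of the indices `0, …, r` into `0, …, c` and `c + 1, …, r`. -/
def splitIdx (hcr : c ≤ r) : Fin (c + 1) ⊕ Fin (r - c) ≃ Fin (r + 1) :=
  finSumFinEquiv.trans (finCongr (by rw [add_right_comm, Nat.add_sub_cancel' hcr]))

theorem colOf_castSucc (t : Fin (r - c)) (q : Fin (c + 1)) :
    colOf r c hcr t q.castSucc = splitIdx hcr (Sum.inl q) := by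
  have : (q : ℕ) ≤ c := by omega
  ext
  simp [colOf, splitIdx, this]

theorem colOf_last (t : Fin (r - c)) :
    colOf r c hcr t (Fin.last (c + 1)) = splitIdx hcr (Sum.inr t) := by
  ext
  simp [colOf, splitIdx]

/-- The variables `T_{ij}` with `i > c`. -/
abbrev HighVar (hcr : c ≤ r) (nn : Fin (r + 1) → ℕ) : Type :=
  Σ t : Fin (r - c), Fin (nn (splitIdx hcr (Sum.inr t)))

/-- The variables `T_{ij}` with `i ≤ c`, and the variables `S_k`. -/
abbrev LowVar (hcr : c ≤ r) (m : ℕ) (nn : Fin (r + 1) → ℕ) : Type :=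
  (Σ i : Fin (c + 1), Fin (nn (splitIdx hcr (Sum.inl i)))) ⊕ Fin m

/-- The splitting of the variables into those with block index `> c` and the rest. -/
def splitVar (hcr : c ≤ r) (m : ℕ) (nn : Fin (r + 1) → ℕ) :
    HighVar hcr nn ⊕ LowVar hcr m nn ≃ VarIdx r m nn :=
  (Equiv.sumAssoc _ _ _).symm.trans <| Equiv.sumCongr
    ((Equiv.sumComm _ _).trans <|
      (Equiv.sumSigmaDistrib fun i => Fin (nn (splitIdx hcr i))).symm.trans <|
        Equiv.sigmaCongrLeft (β := fun i => Fin (nn i)) (splitIdx hcr))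
    (Equiv.refl _)

/-- The polynomial ring, viewed as a polynomial ring in the variables `T_{ij}`, `i > c`. -/
noncomputable def splitPoly (𝕂 : Type) [Field 𝕂] (hcr : c ≤ r) (m : ℕ) (nn : Fin (r + 1) → ℕ) :
    MvPolynomial (HighVar hcr nn) (MvPolynomial (LowVar hcr m nn) 𝕂) ≃+*
      MvPolynomial (VarIdx r m nn) 𝕂 :=
  ((sumAlgEquiv 𝕂 (HighVar hcr nn) (LowVar hcr m nn)).symm.trans
    (renameEquiv 𝕂 (splitVar hcr m nn))).toRingEquiv

theorem splitPoly_X (t : Fin (r - c)) (j : Fin (nn (splitIdx hcr (Sum.inr t)))) :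
    splitPoly 𝕂 hcr m nn (X ⟨t, j⟩) = X (Sum.inl ⟨splitIdx hcr (Sum.inr t), j⟩) := by
  simp [splitPoly]
  rfl

theorem splitPoly_C_X (i : Fin (c + 1)) (j : Fin (nn (splitIdx hcr (Sum.inl i)))) :
    splitPoly 𝕂 hcr m nn (C (X (Sum.inl ⟨i, j⟩))) =
      X (Sum.inl ⟨splitIdx hcr (Sum.inl i), j⟩) := by
  simp [splitPoly]
  rfl

theorem splitPoly_C_C (a : 𝕂) : splitPoly 𝕂 hcr m nn (C (C a)) = C a := by
  simp [splitPoly]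

/-- The polynomial `f_t` in the variables `T_{ij}`, `i ≤ c`, such that `g_t` is a scalar multiple
of `T_{c+t}^{l_{c+t}} - f_t`. -/
noncomputable def lowForm (m : ℕ) (nn : Fin (r + 1) → ℕ) (l : ∀ i : Fin (r + 1), Fin (nn i) → ℕ)
    (hcr : c ≤ r) (A : Matrix (Fin (c + 1)) (Fin (r + 1)) 𝕂) (t : Fin (r - c)) :
    MvPolynomial (LowVar hcr m nn) 𝕂 :=
  -(C (gCoeff hcr A t (Fin.last _))⁻¹ * ∑ q : Fin (c + 1), C (gCoeff hcr A t q.castSucc) *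
    ∏ j, X (Sum.inl ⟨q, j⟩) ^ l (splitIdx hcr (Sum.inl q)) j)

theorem lowForm_ne_zero (hnn : ∀ i, 0 < nn i) (hl : ∀ i j, 0 < l i j)
    (hA : ∀ s : Finset (Fin (r + 1)), s.card = c + 1 →
      LinearIndependent 𝕂 fun j : s => A.transpose (j : Fin (r + 1)))
    (t : Fin (r - c)) : lowForm m nn l hcr A t ≠ 0 := by
  intro h
  have h1 := congrArg (eval (Sum.elim (fun v => if v.1 = 0 then 1 else 0) fun _ => 0)) h
  have hprod : ∀ q : Fin (c + 1), ∏ j, (if q = 0 then (1 : 𝕂) else 0) ^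
      l (splitIdx hcr (Sum.inl q)) j = if q = 0 then 1 else 0 := by
    intro q
    split_ifs
    · simp
    · exact Finset.prod_eq_zero (Finset.mem_univ ⟨0, hnn _⟩) (zero_pow (hl _ _).ne')
  simp only [lowForm, map_neg, map_mul, map_sum, map_prod, map_pow, eval_C, eval_X, Sum.elim_inl,
    hprod, map_zero] at h1
  simp [gCoeff_ne_zero hA] at h1

theorem gPoly_eq_C_mul_splitPoly
    (hA : ∀ s : Finset (Fin (r + 1)), s.card = c + 1 →
      LinearIndependent 𝕂 fun j : s => A.transpose (j : Fin (r + 1)))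
    (t : Fin (r - c)) :
    gPoly 𝕂 r c m hcr nn l A t = C (gCoeff hcr A t (Fin.last _)) *
      splitPoly 𝕂 hcr m nn (∏ j, X ⟨t, j⟩ ^ l (splitIdx hcr (Sum.inr t)) j -
        C (lowForm m nn l hcr A t)) := by
  have hne := gCoeff_ne_zero (hcr := hcr) hA t (Fin.last _)
  rw [gPoly_eq_sum, Fin.sum_univ_castSucc]
  simp only [colOf_castSucc, colOf_last]
  simp only [lowForm, map_sub, map_neg, map_mul, map_sum, map_prod, map_pow, splitPoly_X,
    splitPoly_C_X, splitPoly_C_C, Tmon]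
  rw [sub_neg_eq_add, mul_add, ← mul_assoc (C _) (C _), ← C_mul, mul_inv_cancel₀ hne, C_1, one_mul,
    add_comm]

theorem span_gPoly_eq_map
    (hA : ∀ s : Finset (Fin (r + 1)), s.card = c + 1 →
      LinearIndependent 𝕂 fun j : s => A.transpose (j : Fin (r + 1))) :
    Ideal.span (Set.range (gPoly 𝕂 r c m hcr nn l A)) =
      (blockIdeal (fun v : HighVar hcr nn => l (splitIdx hcr (Sum.inr v.1)) v.2)
        (lowForm m nn l hcr A)).map (splitPoly 𝕂 hcr m nn : _ →+* _) := by
  rw [blockIdeal, Ideal.map_span, ← Set.range_comp]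
  apply le_antisymm <;> refine Ideal.span_le.mpr ?_ <;> rintro _ ⟨t, rfl⟩
  · rw [gPoly_eq_C_mul_splitPoly hA]
    exact Ideal.mul_mem_left _ _ (Ideal.subset_span ⟨t, rfl⟩)
  · have h := Ideal.mul_mem_left (Ideal.span (Set.range (gPoly 𝕂 r c m hcr nn l A)))
      (C (gCoeff hcr A t (Fin.last _))⁻¹) (Ideal.subset_span ⟨t, rfl⟩)
    rwa [gPoly_eq_C_mul_splitPoly hA, ← mul_assoc, ← C_mul,
      inv_mul_cancel₀ (gCoeff_ne_zero hA t _), C_1, one_mul] at h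

theorem isReduced_ringAP [CharZero 𝕂] (hnn : ∀ i, 0 < nn i) (hl : ∀ i j, 0 < l i j)
    (hA : ∀ s : Finset (Fin (r + 1)), s.card = c + 1 →
      LinearIndependent 𝕂 fun j : s => A.transpose (j : Fin (r + 1))) :
    IsReduced (RingAP 𝕂 r c m hcr nn l A) := by
  have : ∀ t : Fin (r - c), Nonempty (Fin (nn (splitIdx hcr (Sum.inr t)))) :=
    fun t => ⟨⟨0, hnn _⟩⟩
  rw [← Ideal.isRadical_iff_quotient_reduced, span_gPoly_eq_map hA, Ideal.map_comap_of_equiv]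
  exact (isRadical_blockIdeal (fun v => hl _ _) (lowForm_ne_zero hnn hl hA)).comap _

/-- Positive weights on the `T_{ij}` for which all monomials `T_i^{l_i}` have the same degree. -/
theorem exists_weights (hnn : ∀ i, 0 < nn i) (hl : ∀ i j, 0 < l i j) :
    ∃ (D : ℕ) (w : ∀ i, Fin (nn i) → ℕ), (∀ i j, 0 < w i j) ∧ ∀ i, ∑ j, w i j * l i j = D := by
  have hpos : 0 < ∏ i, nn i * ∏ j, l i j :=
    Finset.prod_pos fun i _ => Nat.mul_pos (hnn i) (Finset.prod_pos fun j _ => hl i j)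
  have hdvd : ∀ i j, nn i * l i j ∣ ∏ i, nn i * ∏ j, l i j := fun i j =>
    (Nat.mul_dvd_mul_left _ (Finset.dvd_prod_of_mem _ (Finset.mem_univ j))).trans
      (Finset.dvd_prod_of_mem (fun i => nn i * ∏ j, l i j) (Finset.mem_univ i))
  choose w hw using hdvd
  refine ⟨∏ i, nn i * ∏ j, l i j, w, fun i j => ?_, fun i => ?_⟩
  · refine Nat.pos_of_ne_zero fun h => hpos.ne' ?_
    rw [hw i j, h, mul_zero]
  · have hconst : ∀ j, nn i * (w i j * l i j) = ∏ i, nn i * ∏ j, l i j := by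
      intro j
      rw [hw i j]
      ring
    refine Nat.eq_of_mul_eq_mul_left (hnn i) ?_
    rw [Finset.mul_sum, Finset.sum_congr rfl fun j _ => hconst j]
    simp

/-- If `R` is reduced, a ring homomorphism to `R[t]` inducing the identity at `t = 1` sends units
to constant polynomials, so that a unit agrees with its specialization at `t = 0`. -/
theorem eval_zero_eq_of_isUnit {R : Type*} [CommRing R] [IsReduced R] (δ : R →+* Polynomial R)
    (h1 : ∀ x, (δ x).eval 1 = x) {u : R} (hu : IsUnit u) : (δ u).eval 0 = u := by
  have hdeg : (δ u).natDegree = 0 := by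
    by_contra h
    exact Polynomial.not_isUnit_of_natDegree_pos_of_isReduced _ (Nat.pos_of_ne_zero h)
      (hu.map δ)
  obtain ⟨a, ha⟩ := Polynomial.natDegree_eq_zero.mp hdeg
  have h := h1 u
  rw [← ha, Polynomial.eval_C] at h ⊢
  exact h

theorem eval₂Hom_weighted_gPoly {S : Type*} [CommRing S]
    (ψ : MvPolynomial (VarIdx r m nn) 𝕂 →+* S) (s : S) (w : VarIdx r m nn → ℕ) {D : ℕ}
    (hD : ∀ i, ∑ j, w (Sum.inl ⟨i, j⟩) * l i j = D) (t : Fin (r - c)) :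
    eval₂Hom (ψ.comp C) (fun v => s ^ w v * ψ (X v)) (gPoly 𝕂 r c m hcr nn l A t) =
      s ^ D * ψ (gPoly 𝕂 r c m hcr nn l A t) := by
  have hT : ∀ i, eval₂Hom (ψ.comp C) (fun v => s ^ w v * ψ (X v)) (Tmon 𝕂 r m nn l i) =
      s ^ D * ψ (Tmon 𝕂 r m nn l i) := by
    intro i
    simp only [Tmon, map_prod, map_pow, eval₂Hom_X', mul_pow, Finset.prod_mul_distrib,
      ← pow_mul, Finset.prod_pow_eq_pow_sum, hD]
  simp only [gPoly_eq_sum, map_sum, map_mul, hT, Finset.mul_sum, eval₂Hom_C, RingHom.comp_apply]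
  exact Finset.sum_congr rfl fun p _ => by ring

theorem exists_weighted_hom {Q : Type*} [CommRing Q] (π : MvPolynomial (VarIdx r m nn) 𝕂 →+* Q)
    (hnn : ∀ i, 0 < nn i) (hl : ∀ i j, 0 < l i j)
    (hπ : ∀ t, π (gPoly 𝕂 r c m hcr nn l A t) = 0) :
    ∃ φ : MvPolynomial (VarIdx r m nn) 𝕂 →+* Polynomial Q,
      (∀ t, φ (gPoly 𝕂 r c m hcr nn l A t) = 0) ∧ (∀ x, (φ x).eval 1 = π x) ∧
      ∀ x, (φ x).eval 0 = π (C (constantCoeff x)) := by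
  obtain ⟨D, w, hw, hD⟩ := exists_weights hnn hl
  let wt : VarIdx r m nn → ℕ := Sum.elim (fun v => w v.1 v.2) fun _ => 1
  have hwt : ∀ v, wt v ≠ 0 := by
    rintro (v | k)
    · exact (hw _ _).ne'
    · exact one_ne_zero
  refine ⟨eval₂Hom (((Polynomial.C : Q →+* _).comp π).comp C) fun v =>
    Polynomial.X ^ wt v * (Polynomial.C.comp π) (X v), fun t => ?_, fun x => ?_, fun x => ?_⟩
  · have h := eval₂Hom_weighted_gPoly (hcr := hcr) (A := A)
      ((Polynomial.C : Q →+* Polynomial Q).comp π) Polynomial.X wt hD t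
    rwa [RingHom.comp_apply, hπ, map_zero, mul_zero] at h
  · refine RingHom.congr_fun (f := (Polynomial.evalRingHom 1).comp _) ?_ x
    apply MvPolynomial.ringHom_ext <;> simp
  · refine RingHom.congr_fun (f := (Polynomial.evalRingHom 0).comp _)
      (g := (π.comp C).comp constantCoeff) ?_ x
    apply MvPolynomial.ringHom_ext <;> simp [hwt]

theorem nontrivial_ringAP (hnn : ∀ i, 0 < nn i) (hl : ∀ i j, 0 < l i j) :
    Nontrivial (RingAP 𝕂 r c m hcr nn l A) := by
  refine Ideal.Quotient.nontrivial_iff.mpr fun h => ?_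
  have hker : Ideal.span (Set.range (gPoly 𝕂 r c m hcr nn l A)) ≤
      RingHom.ker (constantCoeff : MvPolynomial (VarIdx r m nn) 𝕂 →+* 𝕂) := by
    refine Ideal.span_le.mpr ?_
    rintro _ ⟨t, rfl⟩
    have hT : ∀ i, constantCoeff (Tmon 𝕂 r m nn l i) = 0 := by
      intro i
      rw [Tmon, map_prod]
      refine Finset.prod_eq_zero (Finset.mem_univ ⟨0, hnn i⟩) ?_
      rw [map_pow, constantCoeff_X, zero_pow (hl _ _).ne']
    rw [SetLike.mem_coe, RingHom.mem_ker, gPoly_eq_sum]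
    simp [hT]
  rw [h, top_le_iff] at hker
  exact RingHom.ker_ne_top _ hker

/-- The homomorphism `R → R[t]` multiplying homogeneous elements of weight `d` by `t ^ d`. -/
theorem exists_grading_hom (hnn : ∀ i, 0 < nn i) (hl : ∀ i j, 0 < l i j) :
    ∃ δ : RingAP 𝕂 r c m hcr nn l A →+* Polynomial (RingAP 𝕂 r c m hcr nn l A),
      (∀ x, (δ x).eval 1 = x) ∧
      ∀ x, ∃ a : 𝕂, (δ x).eval 0 = algebraMap 𝕂 (RingAP 𝕂 r c m hcr nn l A) a := by
  obtain ⟨φ, hφ, h1, h0⟩ := exists_weighted_hom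
    (Ideal.Quotient.mk (Ideal.span (Set.range (gPoly 𝕂 r c m hcr nn l A)))) hnn hl
    fun t => Ideal.Quotient.eq_zero_iff_mem.mpr (Ideal.subset_span ⟨t, rfl⟩)
  have hker : Ideal.span (Set.range (gPoly 𝕂 r c m hcr nn l A)) ≤ RingHom.ker φ := by
    refine Ideal.span_le.mpr ?_
    rintro _ ⟨t, rfl⟩
    exact hφ t
  refine ⟨Ideal.Quotient.lift _ φ fun x hx => hker hx, fun x => ?_, fun x => ?_⟩
  · obtain ⟨x, rfl⟩ := Ideal.Quotient.mk_surjective x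
    exact h1 x
  · obtain ⟨x, rfl⟩ := Ideal.Quotient.mk_surjective x
    exact ⟨constantCoeff x, h0 x⟩

end ArrangementRing

/-- Every unit of `R = 𝕂[T_{ij},S_k]/⟨g_1,…,g_{r−c}⟩` is constant,
i.e. the image of a nonzero element of `𝕂` under the structure map `𝕂 → R`. -/
theorem statement_4
    (𝕂 : Type) [Field 𝕂] [IsAlgClosed 𝕂] [CharZero 𝕂]
    (r c m : ℕ) (hc : 0 < c) (hcr : c ≤ r)
    (nn : Fin (r + 1) → ℕ) (hnn : ∀ i, 0 < nn i)
    (l : ∀ i : Fin (r + 1), Fin (nn i) → ℕ) (hl : ∀ i j, 0 < l i j)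
    (A : Matrix (Fin (c + 1)) (Fin (r + 1)) 𝕂)
    (hA : ∀ s : Finset (Fin (r + 1)), s.card = c + 1 →
      LinearIndependent 𝕂 fun j : s => A.transpose (j : Fin (r + 1)))
    :
    ∀ u : (RingAP 𝕂 r c m hcr nn l A)ˣ,
      ∃ a : 𝕂, a ≠ 0 ∧ (u : RingAP 𝕂 r c m hcr nn l A) =
        algebraMap 𝕂 (RingAP 𝕂 r c m hcr nn l A) a := by
  intro u
  have := isReduced_ringAP (m := m) (hcr := hcr) hnn hl hA
  have := nontrivial_ringAP (m := m) (hcr := hcr) (A := A) hnn hl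
  obtain ⟨δ, h1, h0⟩ := exists_grading_hom (m := m) (hcr := hcr) (A := A) hnn hl
  obtain ⟨a, ha⟩ := h0 u
  rw [eval_zero_eq_of_isUnit δ h1 u.isUnit] at ha
  refine ⟨a, ?_, ha⟩
  rintro rfl
  rw [map_zero] at ha
  exact u.ne_zero ha
end
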